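/- Let Ω ⊆ ℝ^N be a domain, 1 < p < ∞, 0 < ε < 1, V ∈ L^1_loc(Ω) with V ≥ 0, and suppose Q_V(w) := ∫_Ω |∇w|^p dx − ∫_Ω V|w|^p dx > 0 for every w ∈ D(Ω) \ {0}. Let f be a linear functional on D(Ω) such that for some C ≥ 0, |f(ζ)| ≤ C·(∫_Ω (|ζ|^p + |∇ζ|^p) dx)^{1/p} for all ζ ∈ D(Ω). Then there exists u ∈ W^{1,p}_0(Ω) with ∫_Ω V|u|^p dx < ∞ such that: (i) for every ζ ∈ D(Ω), ∫_Ω |∇u|^{p−2}∇u·∇ζ dx − (1−ε)∫_Ω V|u|^{p−2}u ζ dx + ε∫_Ω |u|^{p−2}u ζ dx = f(ζ); and (ii) for every ζ ∈ D(Ω), (1/p − 1)·[∫_Ω |∇u|^p dx − (1−ε)∫_Ω V|u|^p dx + ε∫_Ω |u|^p dx] ≤ (1/p)∫_Ω |∇ζ|^p dx − ((1−ε)/p)∫_Ω V|ζ|^p dx + (ε/p)∫_Ω |ζ|^p dx − f(ζ) (i.e., u minimizes the associated functional φ over W^{1,p}_0(Ω)). -/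

import Mathlib

open MeasureTheory Real Filter Topology RealInnerProductSpace

noncomputable section

abbrev Euc (d : ℕ) : Type := EuclideanSpace ℝ (Fin d)

/-- `u` is a test function on `U`: smooth with compact support contained in `U`. -/
def IsTestFun {d : ℕ} (U : Set (Euc d)) (u : Euc d → ℝ) : Prop :=
  ContDiff ℝ (⊤ : ℕ∞) u ∧ HasCompactSupport u ∧ tsupport u ⊆ U

/-- `v` is the weak gradient of `u` on `U`. -/
def HasWeakGradOn {d : ℕ} (U : Set (Euc d)) (u : Euc d → ℝ) (v : Euc d → Euc d) : Prop :=
  ∀ ζ : Euc d → ℝ, IsTestFun U ζ → ∀ i : Fin d,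
    (∫ x in U, u x * fderiv ℝ ζ x (EuclideanSpace.single i 1))
      = - ∫ x in U, v x i * ζ x

/-- The vector field `|s|^{p-2} s` (equal to `0` at `s = 0`). -/
def pvec {d : ℕ} (p : ℝ) (s : Euc d) : Euc d := ‖s‖ ^ (p - 2) • s

/-- The scalar function `|s|^{p-2} s` (equal to `0` at `s = 0`). -/
def psc (p : ℝ) (s : ℝ) : ℝ := |s| ^ (p - 2) * s

/-- The form `Q_V(u) = ∫_Ω |∇u|^p - ∫_Ω V |u|^p` (for smooth `u`). -/
def QV {d : ℕ} (p : ℝ) (U : Set (Euc d)) (V : Euc d → ℝ) (u : Euc d → ℝ) : ℝ :=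
  (∫ x in U, ‖gradient u x‖ ^ p) - ∫ x in U, V x * |u x| ^ p

open scoped ENNReal

/-- A compactness principle for continuous positively homogeneous functions of degree `p`. -/
theorem exists_le_add_of_homogeneous {X : Type*} [NormedAddCommGroup X] [NormedSpace ℝ X]
    [FiniteDimensional ℝ X] {p η : ℝ} (hη : 0 ≤ η) {P R S : X → ℝ}
    (hPc : Continuous P) (hRc : Continuous R) (hSc : Continuous S)
    (hP : ∀ t : ℝ, 0 < t → ∀ x, P (t • x) = t ^ p * P x)
    (hR : ∀ t : ℝ, 0 < t → ∀ x, R (t • x) = t ^ p * R x)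
    (hS : ∀ t : ℝ, 0 < t → ∀ x, S (t • x) = t ^ p * S x)
    (hP0 : P 0 = 0) (hR0 : ∀ x, 0 ≤ R x) (hS0 : ∀ x, 0 ≤ S x)
    (h : ∀ x, x ≠ 0 → S x = 0 → P x < η * R x) :
    ∃ C : ℝ, 0 ≤ C ∧ ∀ x, P x ≤ η * R x + C * S x := by
  have : ProperSpace X := FiniteDimensional.proper_real X
  have hK : IsCompact (Metric.sphere (0 : X) 1 ∩ {x | η * R x ≤ P x}) :=
    (isCompact_sphere 0 1).inter_right (isClosed_le (by fun_prop) hPc)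
  have hpos : ∀ x ∈ Metric.sphere (0 : X) 1 ∩ {x | η * R x ≤ P x}, S x ≠ 0 := by
    rintro x ⟨hx, hx'⟩ h0
    have hx0 : x ≠ 0 := by
      rintro rfl
      simp at hx
    exact absurd (h x hx0 h0) (not_lt.2 hx')
  obtain ⟨C, hC⟩ := hK.bddAbove_image (f := fun x => P x / S x)
    (hPc.continuousOn.div hSc.continuousOn hpos)
  refine ⟨max C 0, le_max_right _ _, fun x => ?_⟩
  have hS' : ∀ y, 0 ≤ max C 0 * S y := fun y => mul_nonneg (le_max_right _ _) (hS0 y)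
  rcases eq_or_ne x 0 with rfl | hx
  · rw [hP0]
    have := mul_nonneg hη (hR0 0)
    linarith [hS' 0]
  have hn : 0 < ‖x‖ := norm_pos_iff.2 hx
  have key : P (‖x‖⁻¹ • x) ≤ η * R (‖x‖⁻¹ • x) + max C 0 * S (‖x‖⁻¹ • x) := by
    set y := ‖x‖⁻¹ • x with hy
    have hy1 : y ∈ Metric.sphere (0 : X) 1 := by
      simp [hy, norm_smul, hn.ne']
    by_cases hle : η * R y ≤ P y
    · have hSy : 0 < S y := lt_of_le_of_ne (hS0 y) (hpos y ⟨hy1, hle⟩).symm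
      have h1 : P y / S y ≤ C := hC ⟨y, ⟨hy1, hle⟩, rfl⟩
      have h2 : P y / S y ≤ max C 0 := h1.trans (le_max_left _ _)
      rw [div_le_iff₀ hSy] at h2
      have := mul_nonneg hη (hR0 y)
      linarith
    · push Not at hle
      linarith [hS' y]
  rw [hP _ (inv_pos.2 hn), hR _ (inv_pos.2 hn), hS _ (inv_pos.2 hn)] at key
  have ht : 0 < ‖x‖⁻¹ ^ p := by positivity
  refine le_of_mul_le_mul_left ?_ ht
  linarith

section Pointwise

variable {E : Type*} [NormedAddCommGroup E] [InnerProductSpace ℝ E]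

theorem norm_midpoint_rpow_lt {p : ℝ} (hp : 1 < p) {a b : E} (hab : a ≠ b) :
    ‖(1 / 2 : ℝ) • (a + b)‖ ^ p < (‖a‖ ^ p + ‖b‖ ^ p) / 2 := by
  have hn : ‖(1 / 2 : ℝ) • (a + b)‖ ≤ (1 / 2 : ℝ) • ‖a‖ + (1 / 2 : ℝ) • ‖b‖ := by
    rw [norm_smul, smul_eq_mul, smul_eq_mul, Real.norm_of_nonneg (by norm_num)]
    linarith [norm_add_le a b]
  rcases eq_or_ne ‖a‖ ‖b‖ with h | h
  · have h1 : ‖(1 / 2 : ℝ) • (a + b)‖ < ‖a‖ := (norm_midpoint_lt_iff h).2 hab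
    have h2 := Real.rpow_lt_rpow (norm_nonneg _) h1 (by linarith : 0 < p)
    rw [← h]
    linarith
  · have h1 := (strictConvexOn_rpow hp).2 (norm_nonneg a) (norm_nonneg b) h
      (by norm_num : (0 : ℝ) < 1 / 2) (by norm_num : (0 : ℝ) < 1 / 2) (by norm_num)
    have h2 := Real.rpow_le_rpow (norm_nonneg _) hn (by linarith : 0 ≤ p)
    simp only [smul_eq_mul] at h1 h2
    linarith

theorem norm_midpoint_rpow_le {p : ℝ} (hp : 1 < p) (a b : E) :
    ‖(1 / 2 : ℝ) • (a + b)‖ ^ p ≤ (‖a‖ ^ p + ‖b‖ ^ p) / 2 := by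
  rcases eq_or_ne a b with rfl | h
  · rw [← two_smul ℝ a, smul_smul]
    norm_num
  · exact (norm_midpoint_rpow_lt hp h).le

theorem norm_smul_rpow {p t : ℝ} (ht : 0 < t) (a : E) : ‖t • a‖ ^ p = t ^ p * ‖a‖ ^ p := by
  rw [norm_smul, Real.norm_of_nonneg ht.le, Real.mul_rpow ht.le (norm_nonneg _)]

/-- Quantitative uniform convexity of `‖·‖ ^ p`. -/
theorem exists_norm_sub_rpow_le [FiniteDimensional ℝ E] {p η : ℝ} (hp : 1 < p) (hη : 0 < η) :
    ∃ C : ℝ, 0 ≤ C ∧ ∀ a b : E, ‖a - b‖ ^ p ≤ η * ‖a‖ ^ p +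
      C * ((‖a‖ ^ p + ‖b‖ ^ p) / 2 - ‖(1 / 2 : ℝ) • (a + b)‖ ^ p) := by
  have hp0 : 0 ≤ p := by linarith
  obtain ⟨C, hC, h⟩ := exists_le_add_of_homogeneous (X := E × E) (p := p) hη.le
    (P := fun x => ‖x.1 - x.2‖ ^ p) (R := fun x => ‖x.1‖ ^ p)
    (S := fun x => (‖x.1‖ ^ p + ‖x.2‖ ^ p) / 2 - ‖(1 / 2 : ℝ) • (x.1 + x.2)‖ ^ p)
    (by fun_prop (disch := exact fun _ => Or.inr hp0))
    (by fun_prop (disch := exact fun _ => Or.inr hp0))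
    (by fun_prop (disch := exact fun _ => Or.inr hp0))
    (fun t ht x => by simp only [Prod.smul_fst, Prod.smul_snd, ← smul_sub, norm_smul_rpow ht])
    (fun t ht x => by simp only [Prod.smul_fst, norm_smul_rpow ht])
    (fun t ht x => by
      simp only [Prod.smul_fst, Prod.smul_snd, ← smul_add, smul_comm _ t, norm_smul_rpow ht]
      ring)
    (by simp [Real.zero_rpow (by linarith : p ≠ 0)])
    (fun x => by positivity) (fun x => sub_nonneg.2 (norm_midpoint_rpow_le hp _ _))
    (fun x hx h0 => by
      have hab : x.1 = x.2 := by
        by_contra hab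
        exact (norm_midpoint_rpow_lt hp hab).ne (by linarith)
      have ha : 0 < ‖x.1‖ := by
        rw [norm_pos_iff]
        intro h1
        exact hx (Prod.ext h1 (hab ▸ h1))
      simp only [hab, sub_self, norm_zero, Real.zero_rpow (by linarith : p ≠ 0)]
      rw [hab] at ha
      positivity)
  exact ⟨C, hC, fun a b => h (a, b)⟩

theorem exists_abs_norm_add_rpow_sub_le [FiniteDimensional ℝ E] {p η : ℝ} (hp : 1 < p)
    (hη : 0 < η) :
    ∃ C : ℝ, 0 ≤ C ∧ ∀ a b : E, |‖a + b‖ ^ p - ‖a‖ ^ p| ≤ η * ‖a‖ ^ p + C * ‖b‖ ^ p := by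
  have hp0 : 0 ≤ p := by linarith
  have hp1 : p ≠ 0 := by linarith
  obtain ⟨C, hC, h⟩ := exists_le_add_of_homogeneous (X := E × E) (p := p) hη.le
    (P := fun x => |‖x.1 + x.2‖ ^ p - ‖x.1‖ ^ p|) (R := fun x => ‖x.1‖ ^ p)
    (S := fun x => ‖x.2‖ ^ p)
    (by fun_prop (disch := exact fun _ => Or.inr hp0))
    (by fun_prop (disch := exact fun _ => Or.inr hp0))
    (by fun_prop (disch := exact fun _ => Or.inr hp0))
    (fun t ht x => by
      simp only [Prod.smul_fst, Prod.smul_snd, ← smul_add, norm_smul_rpow ht]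
      rw [← mul_sub, abs_mul, abs_of_pos (by positivity : 0 < t ^ p)])
    (fun t ht x => by simp only [Prod.smul_fst, norm_smul_rpow ht])
    (fun t ht x => by simp only [Prod.smul_snd, norm_smul_rpow ht])
    (by simp) (fun x => by positivity) (fun x => by positivity)
    (fun x hx h0 => by
      have hb : x.2 = 0 := by
        rwa [Real.rpow_eq_zero (norm_nonneg _) hp1, norm_eq_zero] at h0
      have ha : 0 < ‖x.1‖ := by
        rw [norm_pos_iff]
        intro h1
        exact hx (Prod.ext h1 hb)
      simp only [hb, add_zero, sub_self, abs_zero]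
      positivity)
  exact ⟨C, hC, fun a b => h (a, b)⟩

/-- The tangent inequality for the convex function `‖·‖ ^ p`. -/
theorem norm_rpow_add_inner_le {p : ℝ} (hp : 1 < p) (a b : E) :
    ‖a‖ ^ p + p * (‖a‖ ^ (p - 2) * ⟪a, b - a⟫) ≤ ‖b‖ ^ p := by
  have hp0 : p ≠ 0 := by linarith
  rcases eq_or_ne a 0 with rfl | ha
  · simp [Real.zero_rpow hp0]
    positivity
  have hn : 0 < ‖a‖ := norm_pos_iff.2 ha
  have hc : (p / (p - 1)).HolderConjugate p := (Real.HolderConjugate.conjExponent hp).symm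
  have hy := Real.young_inequality_of_nonneg (a := ‖a‖ ^ (p - 1)) (b := ‖b‖)
    (by positivity) (norm_nonneg _) hc
  rw [← Real.rpow_mul hn.le, mul_div_cancel₀ _ (by linarith : p - 1 ≠ 0)] at hy
  have h1 : ‖a‖ ^ (p - 1) = ‖a‖ ^ (p - 2) * ‖a‖ := by
    rw [← Real.rpow_add_one hn.ne']; ring_nf
  have h2 : ‖a‖ ^ p = ‖a‖ ^ (p - 2) * (‖a‖ * ‖a‖) := by
    rw [← mul_assoc, ← h1, ← Real.rpow_add_one hn.ne']; ring_nf
  have h3 : ‖a‖ ^ (p - 2) * ⟪a, b⟫ ≤ ‖a‖ ^ (p - 1) * ‖b‖ := by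
    rw [h1, mul_assoc]
    exact mul_le_mul_of_nonneg_left (real_inner_le_norm a b) (by positivity)
  rw [inner_sub_right, real_inner_self_eq_norm_mul_norm, mul_sub, ← h2]
  have h4 : p * (‖a‖ ^ (p - 1) * ‖b‖) ≤ (p - 1) * ‖a‖ ^ p + ‖b‖ ^ p := by
    have := mul_le_mul_of_nonneg_left hy (by linarith : 0 ≤ p)
    have e : p * (‖a‖ ^ p / (p / (p - 1)) + ‖b‖ ^ p / p) = (p - 1) * ‖a‖ ^ p + ‖b‖ ^ p := by
      field_simp
    linarith
  have h5 := mul_le_mul_of_nonneg_left h3 (by linarith : 0 ≤ p)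
  linarith

theorem norm_rpow_sub_two_smul {p : ℝ} (hp : 1 < p) (a : E) :
    ‖‖a‖ ^ (p - 2) • a‖ = ‖a‖ ^ (p - 1) := by
  rcases eq_or_ne a 0 with rfl | ha
  · simp [Real.zero_rpow (by linarith : p - 1 ≠ 0)]
  have hn : 0 < ‖a‖ := norm_pos_iff.2 ha
  rw [norm_smul, Real.norm_of_nonneg (by positivity), ← Real.rpow_add_one hn.ne']
  ring_nf

theorem norm_rpow_convex {p : ℝ} (hp : 1 < p) {t : ℝ} (h0 : 0 ≤ t) (h1 : t ≤ 1) (a b : E) :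
    ‖(1 - t) • a + t • b‖ ^ p ≤ (1 - t) * ‖a‖ ^ p + t * ‖b‖ ^ p := by
  have hn : ‖(1 - t) • a + t • b‖ ≤ (1 - t) • ‖a‖ + t • ‖b‖ := by
    refine (norm_add_le _ _).trans_eq ?_
    rw [norm_smul, norm_smul, Real.norm_of_nonneg h0, Real.norm_of_nonneg (sub_nonneg.2 h1),
      smul_eq_mul, smul_eq_mul]
  exact (Real.rpow_le_rpow (norm_nonneg _) hn (by linarith)).trans
    ((convexOn_rpow hp.le).2 (norm_nonneg a) (norm_nonneg b) (sub_nonneg.2 h1) h0 (by ring))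

end Pointwise

theorem tendsto_zero_of_le_add {x : ℕ → ℝ} {M : ℝ} (hx : ∀ k, 0 ≤ x k)
    (h : ∀ η : ℝ, 0 < η → ∃ c : ℕ → ℝ, Tendsto c atTop (𝓝 0) ∧ ∀ k, x k ≤ c k + η * M) :
    Tendsto x atTop (𝓝 0) := by
  rw [Metric.tendsto_atTop]
  intro e he
  obtain ⟨c, hc, hle⟩ := h (e / (2 * (|M| + 1))) (by positivity)
  obtain ⟨n, hn⟩ := (Metric.tendsto_atTop.1 hc) (e / 2) (by positivity)
  refine ⟨n, fun k hk => ?_⟩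
  have h1 := hn k hk
  rw [Real.dist_eq, sub_zero] at h1 ⊢
  rw [abs_of_nonneg (hx k)]
  have h2 : e / (2 * (|M| + 1)) * M ≤ e / 2 := by
    rw [div_mul_eq_mul_div, div_le_div_iff₀ (by positivity) (by norm_num)]
    nlinarith [le_abs_self M, abs_nonneg M]
  linarith [hle k, le_abs_self (c k)]

section Integral

variable {α : Type*} [MeasurableSpace α] {μ : Measure α}
variable {E : Type*} [NormedAddCommGroup E]

theorem MeasureTheory.MemLp.integrable_rpow {p : ℝ} (hp : 1 < p) {w : α → E}
    (hw : MemLp w (ENNReal.ofReal p) μ) : Integrable (fun x => ‖w x‖ ^ p) μ := by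
  have h := hw.integrable_norm_rpow (by simp; linarith) ENNReal.ofReal_ne_top
  rwa [ENNReal.toReal_ofReal (by linarith)] at h

theorem memLp_of_integrable_rpow {p : ℝ} (hp : 1 < p) {w : α → E}
    (hm : AEStronglyMeasurable w μ) (hw : Integrable (fun x => ‖w x‖ ^ p) μ) :
    MemLp w (ENNReal.ofReal p) μ := by
  rw [← integrable_norm_rpow_iff hm (by simp; linarith) ENNReal.ofReal_ne_top,
    ENNReal.toReal_ofReal (by linarith)]
  exact hw

theorem eLpNorm_ofReal_eq {p : ℝ} (hp : 1 < p) {w : α → E} (hw : MemLp w (ENNReal.ofReal p) μ) :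
    eLpNorm w (ENNReal.ofReal p) μ = ENNReal.ofReal ((∫ x, ‖w x‖ ^ p ∂μ) ^ p⁻¹) := by
  rw [hw.eLpNorm_eq_integral_rpow_norm (by simp; linarith) ENNReal.ofReal_ne_top,
    ENNReal.toReal_ofReal (by linarith)]

theorem Lp_norm_rpow {p : ℝ} (hp : 1 < p) (w : Lp E (ENNReal.ofReal p) μ) :
    ‖w‖ ^ p = ∫ x, ‖w x‖ ^ p ∂μ := by
  have h0 : 0 ≤ ∫ x, ‖w x‖ ^ p ∂μ := integral_nonneg fun x => by positivity
  rw [Lp.norm_def, eLpNorm_ofReal_eq hp (Lp.memLp w), ENNReal.toReal_ofReal (by positivity),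
    ← Real.rpow_mul h0, inv_mul_cancel₀ (by linarith), Real.rpow_one]

variable [InnerProductSpace ℝ E]

theorem norm_add_rpow_le {p : ℝ} (hp : 1 < p) (a b : E) :
    ‖a + b‖ ^ p ≤ 2 ^ p * (‖a‖ ^ p + ‖b‖ ^ p) := by
  have h := norm_midpoint_rpow_le hp a b
  rw [norm_smul_rpow (by norm_num), one_div, Real.inv_rpow (by norm_num),
    inv_mul_le_iff₀ (by positivity)] at h
  refine h.trans (mul_le_mul_of_nonneg_left ?_ (by positivity))
  have : 0 ≤ ‖a‖ ^ p + ‖b‖ ^ p := by positivity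
  linarith

theorem norm_sub_rpow_le {p : ℝ} (hp : 1 < p) (a b : E) :
    ‖a - b‖ ^ p ≤ 2 ^ p * (‖a‖ ^ p + ‖b‖ ^ p) := by
  simpa [sub_eq_add_neg] using norm_add_rpow_le hp a (-b)

theorem integral_norm_sub_rpow_le {p : ℝ} (hp : 1 < p) {a b : α → E}
    (ha : MemLp a (ENNReal.ofReal p) μ) (hb : MemLp b (ENNReal.ofReal p) μ) :
    ∫ x, ‖a x - b x‖ ^ p ∂μ ≤ 2 ^ p * (∫ x, ‖a x‖ ^ p ∂μ + ∫ x, ‖b x‖ ^ p ∂μ) := by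
  rw [← integral_add (ha.integrable_rpow hp) (hb.integrable_rpow hp), ← integral_const_mul]
  exact integral_mono ((ha.sub hb).integrable_rpow hp)
    (((ha.integrable_rpow hp).add (hb.integrable_rpow hp)).const_mul _)
    fun x => norm_sub_rpow_le hp _ _

/-- Differentiability of `t ↦ ∫ ‖w + t h‖ ^ p` at `t = 0`. -/
theorem hasDerivAt_integral_norm_rpow {p : ℝ} (hp : 1 < p) {w h : α → E}
    (hw : MemLp w (ENNReal.ofReal p) μ) (hh : MemLp h (ENNReal.ofReal p) μ) :
    HasDerivAt (fun t : ℝ => ∫ x, ‖w x + t • h x‖ ^ p ∂μ)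
      (p * ∫ x, ⟪‖w x‖ ^ (p - 2) • w x, h x⟫ ∂μ) 0 := by
  have hp0 : 0 ≤ p := by linarith
  have hwt : ∀ t : ℝ, MemLp (fun x => w x + t • h x) (ENNReal.ofReal p) μ := fun t =>
    hw.add (hh.const_smul t)
  have hb : Integrable (fun x => p * (‖w x‖ + ‖h x‖) ^ p) μ := by
    refine Integrable.const_mul ?_ p
    have := (hw.norm.add hh.norm).integrable_rpow hp
    refine this.congr (Eventually.of_forall fun x => ?_)
    simp only [Pi.add_apply]
    rw [Real.norm_of_nonneg (by positivity)]
  have hF : ∀ᶠ t : ℝ in 𝓝 0, AEStronglyMeasurable (fun x => ‖w x + t • h x‖ ^ p) μ :=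
    Eventually.of_forall fun t => ((hwt t).integrable_rpow hp).aestronglyMeasurable
  have hF' : AEStronglyMeasurable
      (fun x => p * ⟪‖w x + (0 : ℝ) • h x‖ ^ (p - 2) • (w x + (0 : ℝ) • h x), h x⟫) μ := by
    have h1 : AEStronglyMeasurable (fun x => ‖w x + (0 : ℝ) • h x‖ ^ (p - 2)) μ :=
      ((hwt 0).aestronglyMeasurable.norm.aemeasurable.pow_const _).aestronglyMeasurable
    exact ((h1.smul (hwt 0).aestronglyMeasurable).inner hh.aestronglyMeasurable).const_mul p
  have hbound : ∀ᵐ x ∂μ, ∀ t ∈ Metric.ball (0 : ℝ) 1,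
      ‖p * ⟪‖w x + t • h x‖ ^ (p - 2) • (w x + t • h x), h x⟫‖ ≤ p * (‖w x‖ + ‖h x‖) ^ p := by
    refine Eventually.of_forall fun x t ht => ?_
    rw [Metric.mem_ball, dist_zero_right, Real.norm_eq_abs] at ht
    have h1 : ‖w x + t • h x‖ ≤ ‖w x‖ + ‖h x‖ := by
      refine (norm_add_le _ _).trans (add_le_add le_rfl ?_)
      rw [norm_smul, Real.norm_eq_abs]
      exact mul_le_of_le_one_left (norm_nonneg _) ht.le
    rw [norm_mul, Real.norm_of_nonneg hp0]
    refine mul_le_mul_of_nonneg_left ?_ hp0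
    refine (norm_inner_le_norm _ _).trans ?_
    rw [norm_rpow_sub_two_smul hp]
    have hs : 0 ≤ ‖w x‖ + ‖h x‖ := by positivity
    calc ‖w x + t • h x‖ ^ (p - 1) * ‖h x‖
        ≤ (‖w x‖ + ‖h x‖) ^ (p - 1) * (‖w x‖ + ‖h x‖) :=
          mul_le_mul (Real.rpow_le_rpow (norm_nonneg _) h1 (by linarith))
            (by linarith [norm_nonneg (w x)]) (norm_nonneg _) (by positivity)
      _ = (‖w x‖ + ‖h x‖) ^ p := by
          rw [← Real.rpow_add_one' hs (by linarith)]
          ring_nf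
  have hdiff : ∀ᵐ x ∂μ, ∀ t ∈ Metric.ball (0 : ℝ) 1, HasDerivAt (fun t : ℝ => ‖w x + t • h x‖ ^ p)
      (p * ⟪‖w x + t • h x‖ ^ (p - 2) • (w x + t • h x), h x⟫) t := by
    refine Eventually.of_forall fun x t _ => ?_
    have h1 := hasFDerivAt_norm_rpow (w x + t • h x) hp
    have h2 : HasDerivAt (fun t : ℝ => w x + t • h x) (h x) t := by
      simpa using ((hasDerivAt_id t).smul_const (h x)).const_add (w x)
    have h3 := h1.comp_hasDerivAt t h2
    simp only [smul_apply, innerSL_apply_apply, smul_eq_mul] at h3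
    rw [real_inner_smul_left, ← mul_assoc]
    exact h3
  have key := (hasDerivAt_integral_of_dominated_loc_of_deriv_le (Metric.ball_mem_nhds _ one_pos)
    hF (by simpa using hw.integrable_rpow hp) hF' hbound hb hdiff).2
  simp only [zero_smul, add_zero] at key
  rwa [integral_const_mul] at key

variable [FiniteDimensional ℝ E]

/-- A perturbation tending to zero in `L^p` does not change `∫ ‖a k‖ ^ p` asymptotically. -/
theorem tendsto_integral_norm_add_rpow_sub {p M : ℝ} (hp : 1 < p) {a b : ℕ → α → E}
    (ha : ∀ k, MemLp (a k) (ENNReal.ofReal p) μ) (hb : ∀ k, MemLp (b k) (ENNReal.ofReal p) μ)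
    (hM : ∀ k, ∫ x, ‖a k x‖ ^ p ∂μ ≤ M)
    (hb0 : Tendsto (fun k => ∫ x, ‖b k x‖ ^ p ∂μ) atTop (𝓝 0)) :
    Tendsto (fun k => ∫ x, ‖a k x + b k x‖ ^ p ∂μ - ∫ x, ‖a k x‖ ^ p ∂μ) atTop (𝓝 0) := by
  rw [tendsto_zero_iff_abs_tendsto_zero]
  refine tendsto_zero_of_le_add (M := M) (fun k => abs_nonneg _) fun η hη => ?_
  obtain ⟨C, hC, h⟩ := exists_abs_norm_add_rpow_sub_le (E := E) hp hη
  refine ⟨fun k => C * ∫ x, ‖b k x‖ ^ p ∂μ, by simpa using hb0.const_mul C, fun k => ?_⟩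
  have hab := ((ha k).add (hb k)).integrable_rpow hp
  have ha' := (ha k).integrable_rpow hp
  have hb' := (hb k).integrable_rpow hp
  simp only [Pi.add_apply] at hab
  calc |∫ x, ‖a k x + b k x‖ ^ p ∂μ - ∫ x, ‖a k x‖ ^ p ∂μ|
      = |∫ x, (‖a k x + b k x‖ ^ p - ‖a k x‖ ^ p) ∂μ| := by rw [integral_sub hab ha']
    _ ≤ ∫ x, |‖a k x + b k x‖ ^ p - ‖a k x‖ ^ p| ∂μ := abs_integral_le_integral_abs
    _ ≤ ∫ x, (η * ‖a k x‖ ^ p + C * ‖b k x‖ ^ p) ∂μ :=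
        integral_mono (hab.sub ha').abs ((ha'.const_mul η).add (hb'.const_mul C)) fun x => h _ _
    _ = η * ∫ x, ‖a k x‖ ^ p ∂μ + C * ∫ x, ‖b k x‖ ^ p ∂μ := by
        rw [integral_add (ha'.const_mul η) (hb'.const_mul C), integral_const_mul,
          integral_const_mul]
    _ ≤ C * ∫ x, ‖b k x‖ ^ p ∂μ + η * M := by
        linarith [mul_le_mul_of_nonneg_left (hM k) hη.le]

theorem tendsto_integral_norm_rpow_of_sub {p : ℝ} (hp : 1 < p) {a : ℕ → α → E} {b : α → E}
    (ha : ∀ k, MemLp (a k) (ENNReal.ofReal p) μ) (hb : MemLp b (ENNReal.ofReal p) μ)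
    (h : Tendsto (fun k => ∫ x, ‖a k x - b x‖ ^ p ∂μ) atTop (𝓝 0)) :
    Tendsto (fun k => ∫ x, ‖a k x‖ ^ p ∂μ) atTop (𝓝 (∫ x, ‖b x‖ ^ p ∂μ)) := by
  have := tendsto_integral_norm_add_rpow_sub hp (fun _ => hb) (fun k => (ha k).sub hb)
    (fun _ => le_rfl) h
  simpa using this.add_const (∫ x, ‖b x‖ ^ p ∂μ)

/-- The Brezis–Lieb lemma. -/
theorem tendsto_integral_norm_rpow_sub_of_ae {p M : ℝ} (hp : 1 < p) {a : ℕ → α → E} {b : α → E}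
    (ha : ∀ k, MemLp (a k) (ENNReal.ofReal p) μ) (hb : MemLp b (ENNReal.ofReal p) μ)
    (hM : ∀ k, ∫ x, ‖a k x‖ ^ p ∂μ ≤ M)
    (hae : ∀ᵐ x ∂μ, Tendsto (fun k => a k x) atTop (𝓝 (b x))) :
    Tendsto (fun k => ∫ x, ‖a k x‖ ^ p ∂μ - ∫ x, ‖a k x - b x‖ ^ p ∂μ) atTop
      (𝓝 (∫ x, ‖b x‖ ^ p ∂μ)) := by
  have hp0 : 0 ≤ p := by linarith
  have hp1 : p ≠ 0 := by linarith
  have hb' := hb.integrable_rpow hp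
  have ha' := fun k => (ha k).integrable_rpow hp
  have hd' := fun k => ((ha k).sub hb).integrable_rpow hp
  simp only [Pi.sub_apply] at hd'
  have hg' := fun k => ((ha' k).sub (hd' k)).sub hb'
  rw [tendsto_iff_norm_sub_tendsto_zero]
  simp only [Real.norm_eq_abs]
  refine tendsto_zero_of_le_add (M := 2 ^ p * (M + ∫ x, ‖b x‖ ^ p ∂μ))
    (fun k => abs_nonneg _) fun η hη => ?_
  obtain ⟨C, hC, h⟩ := exists_abs_norm_add_rpow_sub_le (E := E) hp hη
  set W : ℕ → α → ℝ := fun k x =>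
    max (|‖a k x‖ ^ p - ‖a k x - b x‖ ^ p - ‖b x‖ ^ p| - η * ‖a k x - b x‖ ^ p) 0 with hW
  have hWi : ∀ k, Integrable (W k) μ := fun k =>
    ((hg' k).abs.sub ((hd' k).const_mul η)).sup (integrable_zero _ _ _)
  have hW0 : Tendsto (fun k => ∫ x, W k x ∂μ) atTop (𝓝 0) := by
    rw [← integral_zero α ℝ (μ := μ)]
    refine tendsto_integral_of_dominated_convergence (fun x => (C + 1) * ‖b x‖ ^ p)
      (fun k => (hWi k).aestronglyMeasurable) (hb'.const_mul _) (fun k => ?_) ?_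
    · refine Eventually.of_forall fun x => ?_
      have h1 := h (a k x - b x) (b x)
      rw [sub_add_cancel] at h1
      have h2 : 0 ≤ ‖b x‖ ^ p := by positivity
      rw [Real.norm_of_nonneg (le_max_right _ _)]
      refine max_le ?_ (by positivity)
      have h3 := abs_sub (‖a k x‖ ^ p - ‖a k x - b x‖ ^ p) (‖b x‖ ^ p)
      rw [abs_of_nonneg h2] at h3
      linarith
    · filter_upwards [hae] with x hx
      have c1 : Tendsto (fun k => ‖a k x‖ ^ p) atTop (𝓝 (‖b x‖ ^ p)) :=
        hx.norm.rpow_const (Or.inr hp0)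
      have c2 : Tendsto (fun k => ‖a k x - b x‖ ^ p) atTop (𝓝 0) := by
        have := (hx.sub_const (b x)).norm.rpow_const (p := p) (Or.inr hp0)
        simpa [Real.zero_rpow hp1] using this
      have c3 := (((c1.sub c2).sub_const (‖b x‖ ^ p)).abs.sub (c2.const_mul η)).max
        (tendsto_const_nhds (x := (0 : ℝ)))
      simpa using c3
  refine ⟨_, hW0, fun k => ?_⟩
  have hsub := integral_norm_sub_rpow_le hp (ha k) hb
  have hsub2 : ∫ x, ‖a k x - b x‖ ^ p ∂μ ≤ 2 ^ p * (M + ∫ x, ‖b x‖ ^ p ∂μ) :=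
    hsub.trans (mul_le_mul_of_nonneg_left (by linarith [hM k]) (by positivity))
  calc |∫ x, ‖a k x‖ ^ p ∂μ - ∫ x, ‖a k x - b x‖ ^ p ∂μ - ∫ x, ‖b x‖ ^ p ∂μ|
      = |∫ x, (‖a k x‖ ^ p - ‖a k x - b x‖ ^ p - ‖b x‖ ^ p) ∂μ| := by
        rw [integral_sub (f := fun x => ‖a k x‖ ^ p - ‖a k x - b x‖ ^ p) ((ha' k).sub (hd' k)) hb',
          integral_sub (ha' k) (hd' k)]
    _ ≤ ∫ x, |‖a k x‖ ^ p - ‖a k x - b x‖ ^ p - ‖b x‖ ^ p| ∂μ := abs_integral_le_integral_abs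
    _ ≤ ∫ x, (W k x + η * ‖a k x - b x‖ ^ p) ∂μ := by
        refine integral_mono (hg' k).abs ((hWi k).add ((hd' k).const_mul η)) fun x => ?_
        have : |‖a k x‖ ^ p - ‖a k x - b x‖ ^ p - ‖b x‖ ^ p| - η * ‖a k x - b x‖ ^ p ≤ W k x :=
          le_max_left _ _
        simp only
        linarith
    _ = ∫ x, W k x ∂μ + η * ∫ x, ‖a k x - b x‖ ^ p ∂μ := by
        rw [integral_add (hWi k) ((hd' k).const_mul η), integral_const_mul]
    _ ≤ _ := by
        have := mul_le_mul_of_nonneg_left hsub2 hη.le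
        linarith

end Integral

theorem exists_mul_le_rpow_add {p : ℝ} (hp : 1 < p) {A e : ℝ} (hA : 0 ≤ A) (he : 0 < e) :
    ∃ K : ℝ, ∀ s : ℝ, 0 ≤ s → A * s ≤ e * s ^ p + K := by
  have hc : (p / (p - 1)).HolderConjugate p := (Real.HolderConjugate.conjExponent hp).symm
  set δ : ℝ := (e * p) ^ (1 / p) with hδ
  have hp0 : 0 < p := by linarith
  have hδ0 : 0 < δ := by positivity
  have hδp : δ ^ p = e * p := by
    rw [hδ, ← Real.rpow_mul (by positivity), one_div_mul_cancel hp0.ne', Real.rpow_one]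
  refine ⟨(A / δ) ^ (p / (p - 1)) / (p / (p - 1)), fun s hs => ?_⟩
  have h := Real.young_inequality_of_nonneg (a := A / δ) (b := δ * s) (by positivity)
    (by positivity) hc
  rw [Real.mul_rpow hδ0.le hs, hδp] at h
  have e1 : A / δ * (δ * s) = A * s := by field_simp
  have e2 : e * p * s ^ p / p = e * s ^ p := by field_simp
  linarith

section Riesz

variable {α : Type*} [MeasurableSpace α] {μ : Measure α}
variable {E : Type*} [NormedAddCommGroup E] [InnerProductSpace ℝ E]

theorem memLp_rpow_sub_two_smul {p q : ℝ} (hp : 1 < p) (hpq : p.HolderConjugate q) {w : α → E}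
    (hw : MemLp w (ENNReal.ofReal p) μ) :
    MemLp (fun x => ‖w x‖ ^ (p - 2) • w x) (ENNReal.ofReal q) μ := by
  have hm : AEStronglyMeasurable (fun x => ‖w x‖ ^ (p - 2)) μ :=
    (hw.aestronglyMeasurable.norm.aemeasurable.pow_const _).aestronglyMeasurable
  refine memLp_of_integrable_rpow hpq.symm.lt (hm.smul hw.aestronglyMeasurable) ?_
  refine (hw.integrable_rpow hp).congr (Eventually.of_forall fun x => ?_)
  simp only
  rw [norm_rpow_sub_two_smul hp, ← Real.rpow_mul (norm_nonneg _), hpq.sub_one_mul_conj]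

theorem integrable_inner_of_memLp {p q : ℝ} (hpq : p.HolderConjugate q) {g w : α → E}
    (hg : MemLp g (ENNReal.ofReal q) μ) (hw : MemLp w (ENNReal.ofReal p) μ) :
    Integrable (fun x => ⟪g x, w x⟫) μ := by
  have : (ENNReal.ofReal p).HolderConjugate (ENNReal.ofReal q) := hpq.ennrealOfReal
  have h := MemLp.integrable_mul (p := ENNReal.ofReal q) (q := ENNReal.ofReal p)
    hg.norm hw.norm
  refine h.mono' (hg.aestronglyMeasurable.inner hw.aestronglyMeasurable)
    (Eventually.of_forall fun x => ?_)
  simpa using norm_inner_le_norm (𝕜 := ℝ) (g x) (w x)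

theorem abs_integral_inner_le {p q : ℝ} (hpq : p.HolderConjugate q) {g w : α → E}
    (hg : MemLp g (ENNReal.ofReal q) μ) (hw : MemLp w (ENNReal.ofReal p) μ) :
    |∫ x, ⟪g x, w x⟫ ∂μ| ≤ (∫ x, ‖g x‖ ^ q ∂μ) ^ (1 / q) * (∫ x, ‖w x‖ ^ p ∂μ) ^ (1 / p) := by
  have : (ENNReal.ofReal p).HolderConjugate (ENNReal.ofReal q) := hpq.ennrealOfReal
  refine le_trans abs_integral_le_integral_abs
    (le_trans ?_ (integral_mul_norm_le_Lp_mul_Lq hpq.symm hg hw))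
  exact integral_mono (integrable_inner_of_memLp hpq hg hw).abs
    (MemLp.integrable_mul (p := ENNReal.ofReal q) (q := ENNReal.ofReal p) hg.norm hw.norm)
    fun x => abs_real_inner_le_norm (g x) (w x)

/-- Products of strongly convergent multiples of a fixed function with weakly null sequences. -/
theorem tendsto_integral_mul_inner_of_weak {p q M : ℝ} (hpq : p.HolderConjugate q) {G : α → E}
    (hG : MemLp G (ENNReal.ofReal q) μ) {b : ℕ → α → E}
    (hb : ∀ k, MemLp (b k) (ENNReal.ofReal p) μ) (hM : ∀ k, ∫ x, ‖b k x‖ ^ p ∂μ ≤ M)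
    (hw : ∀ H : α → E, MemLp H (ENNReal.ofReal q) μ →
      Tendsto (fun k => ∫ x, ⟪H x, b k x⟫ ∂μ) atTop (𝓝 0))
    {θ : ℕ → α → ℝ} {ψ : α → ℝ} (hθm : ∀ k, AEStronglyMeasurable (θ k) μ)
    (hψm : AEStronglyMeasurable ψ μ) (hθ1 : ∀ k x, |θ k x| ≤ 1) (hψ1 : ∀ x, |ψ x| ≤ 1)
    (hθ : ∀ᵐ x ∂μ, Tendsto (fun k => θ k x) atTop (𝓝 (ψ x))) :
    Tendsto (fun k => ∫ x, θ k x * ⟪G x, b k x⟫ ∂μ) atTop (𝓝 0) := by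
  have hp : 1 < p := hpq.lt
  have hq : 1 < q := hpq.symm.lt
  have hsm : ∀ c : α → ℝ, AEStronglyMeasurable c μ → (∀ x, |c x| ≤ 2) →
      MemLp (fun x => c x • G x) (ENNReal.ofReal q) μ := fun c hc h2 =>
    (hG.const_smul (2 : ℝ)).mono (hc.smul hG.aestronglyMeasurable)
      (Eventually.of_forall fun x => by
        simp only [Pi.smul_apply]
        rw [norm_smul, norm_smul, Real.norm_eq_abs, Real.norm_of_nonneg (by norm_num)]
        exact mul_le_mul_of_nonneg_right (h2 x) (norm_nonneg _))
  have hψG := hsm ψ hψm fun x => (hψ1 x).trans (by norm_num)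
  have hdG := fun k => hsm (fun x => θ k x - ψ x) ((hθm k).sub hψm) fun x =>
    (abs_sub _ _).trans (by linarith [hθ1 k x, hψ1 x])
  have hD : Tendsto (fun k => ∫ x, ‖(θ k x - ψ x) • G x‖ ^ q ∂μ) atTop (𝓝 0) := by
    rw [← integral_zero α ℝ (μ := μ)]
    refine tendsto_integral_of_dominated_convergence (fun x => ‖(2 : ℝ) • G x‖ ^ q)
      (fun k => ((hdG k).integrable_rpow hq).aestronglyMeasurable)
      ((hG.const_smul (2 : ℝ)).integrable_rpow hq) (fun k => Eventually.of_forall fun x => ?_) ?_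
    · rw [Real.norm_of_nonneg (by positivity), norm_smul, norm_smul, Real.norm_eq_abs,
        Real.norm_of_nonneg (by norm_num)]
      have : |θ k x - ψ x| ≤ 2 := (abs_sub _ _).trans (by linarith [hθ1 k x, hψ1 x])
      exact Real.rpow_le_rpow (by positivity) (mul_le_mul_of_nonneg_right this (norm_nonneg _))
        (by linarith)
    · filter_upwards [hθ] with x hx
      have := ((hx.sub_const (ψ x)).smul_const (G x)).norm.rpow_const (p := q)
        (Or.inr (by linarith))
      simpa [Real.zero_rpow (by linarith : q ≠ 0)] using this
  have h1 : Tendsto (fun k => ∫ x, ⟪(θ k x - ψ x) • G x, b k x⟫ ∂μ) atTop (𝓝 0) := by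
    refine squeeze_zero_norm (a := fun k => (∫ x, ‖(θ k x - ψ x) • G x‖ ^ q ∂μ) ^ (1 / q) *
      M ^ (1 / p)) (fun k => ?_) ?_
    · refine (abs_integral_inner_le hpq (hdG k) (hb k)).trans ?_
      refine mul_le_mul_of_nonneg_left (Real.rpow_le_rpow ?_ (hM k) ?_) ?_
      · exact integral_nonneg fun x => by positivity
      · have : 0 < p := by linarith
        positivity
      · exact Real.rpow_nonneg (integral_nonneg fun x => by positivity) _
    · have := (hD.rpow_const (p := 1 / q) (Or.inr (by positivity))).mul_const (M ^ (1 / p))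
      simpa [Real.zero_rpow (by positivity : q⁻¹ ≠ 0)] using this
  have h2 := h1.add (hw _ hψG)
  rw [add_zero] at h2
  refine h2.congr fun k => ?_
  rw [← integral_add (integrable_inner_of_memLp hpq (hdG k) (hb k))
    (integrable_inner_of_memLp hpq hψG (hb k))]
  refine integral_congr_ae (Eventually.of_forall fun x => ?_)
  simp only [real_inner_smul_left]
  ring

variable [FiniteDimensional ℝ E]

/-- Uniform convexity of `L^p` in integrated form. -/
theorem exists_Lp_norm_sub_rpow_le {p η : ℝ} (hp : 1 < p) (hη : 0 < η)
    [Fact (1 ≤ ENNReal.ofReal p)] :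
    ∃ C : ℝ, 0 ≤ C ∧ ∀ a b : Lp E (ENNReal.ofReal p) μ, ‖a - b‖ ^ p ≤ η * ‖a‖ ^ p +
      C * ((‖a‖ ^ p + ‖b‖ ^ p) / 2 - ‖(1 / 2 : ℝ) • (a + b)‖ ^ p) := by
  obtain ⟨C, hC, h⟩ := exists_norm_sub_rpow_le (E := E) hp hη
  refine ⟨C, hC, fun a b => ?_⟩
  have ha := (Lp.memLp a).integrable_rpow hp
  have hb := (Lp.memLp b).integrable_rpow hp
  have hm := ((((Lp.memLp a).add (Lp.memLp b)).const_smul (1 / 2 : ℝ))).integrable_rpow hp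
  have hd := ((Lp.memLp a).sub (Lp.memLp b)).integrable_rpow hp
  simp only [Pi.smul_apply, Pi.add_apply, Pi.sub_apply] at hm hd
  have hs : Integrable (fun x => (‖a x‖ ^ p + ‖b x‖ ^ p) / 2 -
      ‖(1 / 2 : ℝ) • (a x + b x)‖ ^ p) μ := ((ha.add hb).div_const 2).sub hm
  have e1 : ∫ x, ‖(a - b) x‖ ^ p ∂μ = ∫ x, ‖a x - b x‖ ^ p ∂μ := by
    refine integral_congr_ae ?_
    filter_upwards [Lp.coeFn_sub a b] with x hx
    rw [hx, Pi.sub_apply]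
  have e2 : ∫ x, ‖((1 / 2 : ℝ) • (a + b)) x‖ ^ p ∂μ
      = ∫ x, ‖(1 / 2 : ℝ) • (a x + b x)‖ ^ p ∂μ := by
    refine integral_congr_ae ?_
    filter_upwards [Lp.coeFn_smul (1 / 2 : ℝ) (a + b), Lp.coeFn_add a b] with x hx hx'
    rw [hx, Pi.smul_apply, hx', Pi.add_apply]
  simp only [Lp_norm_rpow hp]
  rw [e1, e2]
  calc ∫ x, ‖a x - b x‖ ^ p ∂μ
      ≤ ∫ x, (η * ‖a x‖ ^ p +
        C * ((‖a x‖ ^ p + ‖b x‖ ^ p) / 2 - ‖(1 / 2 : ℝ) • (a x + b x)‖ ^ p)) ∂μ :=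
        integral_mono hd ((ha.const_mul η).add (hs.const_mul C)) fun x => h _ _
    _ = _ := by
        rw [integral_add (ha.const_mul η) (hs.const_mul C), integral_const_mul,
          integral_const_mul, integral_sub (f := fun x => (‖a x‖ ^ p + ‖b x‖ ^ p) / 2)
            ((ha.add hb).div_const 2) hm, integral_div, integral_add ha hb]

theorem exists_forall_norm_rpow_sub_le {p : ℝ} (hp : 1 < p)
    [Fact (1 ≤ ENNReal.ofReal p)] (l : Lp E (ENNReal.ofReal p) μ →L[ℝ] ℝ) :
    ∃ w : Lp E (ENNReal.ofReal p) μ, ∀ w', ‖w‖ ^ p / p - l w ≤ ‖w'‖ ^ p / p - l w' := by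
  have hp0 : 0 < p := by linarith
  set J : Lp E (ENNReal.ofReal p) μ → ℝ := fun w => ‖w‖ ^ p / p - l w with hJ
  obtain ⟨K, hK⟩ := exists_mul_le_rpow_add hp (norm_nonneg l)
    (by positivity : (0 : ℝ) < 1 / (2 * p))
  have hlow : ∀ w, ‖w‖ ^ p / (2 * p) - K ≤ J w := by
    intro w
    have h1 := hK ‖w‖ (norm_nonneg _)
    have h2 : l w ≤ ‖l‖ * ‖w‖ := (le_abs_self _).trans (l.le_opNorm w)
    have h3 : ‖w‖ ^ p / p = ‖w‖ ^ p / (2 * p) + 1 / (2 * p) * ‖w‖ ^ p := by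
      field_simp; ring
    simp only [hJ]
    linarith
  have hbdd : BddBelow (Set.range J) := ⟨-K, by
    rintro _ ⟨w, rfl⟩
    have : 0 ≤ ‖w‖ ^ p / (2 * p) := by positivity
    linarith [hlow w]⟩
  set m := ⨅ w, J w with hm
  have hseq : ∀ k : ℕ, ∃ w, J w < m + 1 / ((k : ℝ) + 1) := fun k =>
    exists_lt_of_ciInf_lt (by linarith [(by positivity : (0 : ℝ) < 1 / ((k : ℝ) + 1))])
  choose w hw using hseq
  have hmle : ∀ w, m ≤ J w := fun w => ciInf_le hbdd w
  set M : ℝ := 2 * p * (m + 1 + K) with hM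
  have hMb : ∀ k, ‖w k‖ ^ p ≤ M := by
    intro k
    have h1 := hlow (w k)
    have h2 : 1 / ((k : ℝ) + 1) ≤ 1 := by
      rw [div_le_one (by positivity)]
      linarith [(Nat.cast_nonneg k : (0 : ℝ) ≤ k)]
    have h3 : ‖w k‖ ^ p / (2 * p) ≤ m + 1 + K := by linarith [hw k]
    rw [div_le_iff₀ (by positivity)] at h3
    rw [hM]; linarith
  have hmid : ∀ j k, (‖w j‖ ^ p + ‖w k‖ ^ p) / 2 - ‖(1 / 2 : ℝ) • (w j + w k)‖ ^ p
      ≤ p * (1 / ((j : ℝ) + 1) + 1 / ((k : ℝ) + 1)) := by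
    intro j k
    have h1 := hmle ((1 / 2 : ℝ) • (w j + w k))
    have h2 := hw j
    have h3 := hw k
    have pj : (0 : ℝ) < 1 / ((j : ℝ) + 1) := by positivity
    have pk : (0 : ℝ) < 1 / ((k : ℝ) + 1) := by positivity
    simp only [hJ, map_smul, map_add, smul_eq_mul] at h1 h2 h3
    have h4 : ((‖w j‖ ^ p + ‖w k‖ ^ p) / 2 - ‖(1 / 2 : ℝ) • (w j + w k)‖ ^ p) / p
      ≤ 1 / ((j : ℝ) + 1) + 1 / ((k : ℝ) + 1) := by
      have : ((‖w j‖ ^ p + ‖w k‖ ^ p) / 2 - ‖(1 / 2 : ℝ) • (w j + w k)‖ ^ p) / p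
        = (‖w j‖ ^ p / p + ‖w k‖ ^ p / p) / 2 - ‖(1 / 2 : ℝ) • (w j + w k)‖ ^ p / p := by ring
      linarith
    rw [div_le_iff₀ hp0] at h4
    linarith
  have hcau : CauchySeq w := by
    rw [Metric.cauchySeq_iff]
    intro r hr
    have hM0 : 0 ≤ M := le_trans (by positivity) (hMb 0)
    have hrp : 0 < r ^ p := by positivity
    obtain ⟨C, hC, h⟩ := exists_Lp_norm_sub_rpow_le (E := E) (μ := μ) (η := r ^ p / (2 * (M + 1)))
      hp (by positivity)
    have hlim : Tendsto (fun n : ℕ => C * (p * (2 * (1 / ((n : ℝ) + 1))))) atTop (𝓝 0) := by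
      simpa using (((tendsto_one_div_add_atTop_nhds_zero_nat (𝕜 := ℝ)).const_mul 2).const_mul
        p).const_mul C
    obtain ⟨n, hn⟩ := (hlim.eventually (gt_mem_nhds (by positivity : 0 < r ^ p / 2))).exists
    refine ⟨n, fun j hj k hk => ?_⟩
    have e1 : 1 / ((j : ℝ) + 1) ≤ 1 / ((n : ℝ) + 1) := Nat.one_div_le_one_div hj
    have e2 : 1 / ((k : ℝ) + 1) ≤ 1 / ((n : ℝ) + 1) := Nat.one_div_le_one_div hk
    have e3 := (hmid j k).trans (mul_le_mul_of_nonneg_left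
      (by linarith : _ ≤ 2 * (1 / ((n : ℝ) + 1))) hp0.le)
    have e4 := mul_le_mul_of_nonneg_left e3 hC
    have e5 : r ^ p / (2 * (M + 1)) * ‖w j‖ ^ p ≤ r ^ p / 2 := by
      rw [div_mul_eq_mul_div, div_le_div_iff₀ (by positivity) (by norm_num)]
      nlinarith [hMb j]
    have e6 : ‖w j - w k‖ ^ p < r ^ p := by linarith [h (w j) (w k)]
    rw [dist_eq_norm]
    exact (Real.rpow_lt_rpow_iff (norm_nonneg _) hr.le hp0).1 e6
  obtain ⟨w0, hw0⟩ := cauchySeq_tendsto_of_complete hcau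
  refine ⟨w0, fun w' => ?_⟩
  have hc : Continuous J := by
    have : Continuous fun w : Lp E (ENNReal.ofReal p) μ => ‖w‖ ^ p :=
      continuous_norm.rpow_const fun _ => Or.inr hp0.le
    exact (this.div_const p).sub l.continuous
  have h1 : J w0 ≤ m := by
    refine le_of_tendsto_of_tendsto' ((hc.tendsto w0).comp hw0) ?_ fun k => (hw k).le
    simpa using (tendsto_one_div_add_atTop_nhds_zero_nat (𝕜 := ℝ)).const_add m
  exact h1.trans (hmle w')

/-- Riesz representation of continuous linear functionals on `L^p`. -/
theorem exists_memLp_forall_eq_integral {p q : ℝ} (hpq : p.HolderConjugate q)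
    [Fact (1 ≤ ENNReal.ofReal p)] (l : Lp E (ENNReal.ofReal p) μ →L[ℝ] ℝ) :
    ∃ g : α → E, MemLp g (ENNReal.ofReal q) μ ∧
      ∀ w : Lp E (ENNReal.ofReal p) μ, l w = ∫ x, ⟪g x, w x⟫ ∂μ := by
  have hp : 1 < p := hpq.lt
  obtain ⟨w, hw⟩ := exists_forall_norm_rpow_sub_le hp l
  refine ⟨_, memLp_rpow_sub_two_smul hp hpq (Lp.memLp w), fun h => ?_⟩
  have hd := ((hasDerivAt_integral_norm_rpow hp (Lp.memLp w) (Lp.memLp h)).div_const p).sub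
    ((hasDerivAt_id (0 : ℝ)).mul_const (l h))
  have hmin : IsLocalMin (fun t : ℝ => (∫ x, ‖w x + t • h x‖ ^ p ∂μ) / p - id t * l h) 0 := by
    refine Eventually.of_forall fun t => ?_
    have h1 := hw (w + t • h)
    have e1 : ∫ x, ‖(w + t • h) x‖ ^ p ∂μ = ∫ x, ‖w x + t • h x‖ ^ p ∂μ := by
      refine integral_congr_ae ?_
      filter_upwards [Lp.coeFn_add w (t • h), Lp.coeFn_smul t h] with x hx hx'
      rw [hx, Pi.add_apply, hx', Pi.smul_apply]
    rw [Lp_norm_rpow hp, Lp_norm_rpow hp, e1, map_add, map_smul, smul_eq_mul] at h1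
    simp only [zero_smul, add_zero, id, zero_mul]
    linarith
  have h0 := hmin.hasDerivAt_eq_zero hd
  rw [mul_div_cancel_left₀ _ (by linarith)] at h0
  linarith

/-- Weak sequential compactness of bounded sequences in a closed convex subset of `L^p`. -/
theorem exists_subseq_tendsto_integral_inner {p q : ℝ} (hpq : p.HolderConjugate q)
    [Fact (1 ≤ ENNReal.ofReal p)] [MeasurableSpace.CountablyGenerated α] [SFinite μ]
    {S : Set (Lp E (ENNReal.ofReal p) μ)} (hSc : IsClosed S) (hSx : Convex ℝ S)
    {w : ℕ → Lp E (ENNReal.ofReal p) μ} (hw : ∀ k, w k ∈ S) {M : ℝ} (hM : ∀ k, ‖w k‖ ≤ M) :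
    ∃ n : ℕ → ℕ, StrictMono n ∧ ∃ w0 ∈ S, ∀ g : α → E, MemLp g (ENNReal.ofReal q) μ →
      Tendsto (fun k => ∫ x, ⟪g x, w (n k) x⟫ ∂μ) atTop (𝓝 (∫ x, ⟪g x, w0 x⟫ ∂μ)) := by
  have hq : 1 < q := hpq.symm.lt
  have hF : Fact (1 ≤ ENNReal.ofReal q) := ⟨by simpa using hq.le⟩
  have hF' : Fact (ENNReal.ofReal q ≠ ∞) := ⟨ENNReal.ofReal_ne_top⟩
  have hH : (ENNReal.ofReal p).HolderConjugate (ENNReal.ofReal q) := hpq.ennrealOfReal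
  obtain ⟨T, hTe⟩ : ∃ T : Lp E (ENNReal.ofReal p) μ →
      StrongDual ℝ (Lp E (ENNReal.ofReal q) μ), ∀ v g, T v g = ∫ x, ⟪g x, v x⟫ ∂μ := by
    refine ⟨(innerSL ℝ : E →L[ℝ] E →L[ℝ] ℝ).lpPairing μ (ENNReal.ofReal p) (ENNReal.ofReal q),
      fun v g => ?_⟩
    rw [ContinuousLinearMap.lpPairing_eq_integral]
    exact integral_congr_ae (Eventually.of_forall fun x => real_inner_comm _ _)
  have hmem : ∀ k, StrongDual.toWeakDual (T (w k)) ∈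
      WeakDual.toStrongDual ⁻¹' Metric.closedBall
        (0 : StrongDual ℝ (Lp E (ENNReal.ofReal q) μ)) M := by
    intro k
    refine (dist_zero_right (T (w k))).trans_le ?_
    refine le_trans (ContinuousLinearMap.opNorm_le_bound (T (w k)) (norm_nonneg (w k))
      fun g => ?_) (hM k)
    have h := abs_integral_inner_le hpq (Lp.memLp g) (Lp.memLp (w k))
    rw [← Lp_norm_rpow hq, ← Lp_norm_rpow hpq.lt, one_div, one_div,
      Real.rpow_rpow_inv (norm_nonneg _) (by linarith),
      Real.rpow_rpow_inv (norm_nonneg _) hpq.ne_zero] at h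
    rw [hTe, Real.norm_eq_abs, mul_comm]
    exact h
  obtain ⟨l, -, n, hn, hl⟩ := WeakDual.isSeqCompact_closedBall ℝ _ _ _ hmem
  obtain ⟨w0, hw0, hrep⟩ := exists_memLp_forall_eq_integral hpq.symm (WeakDual.toStrongDual l)
  have hconv : ∀ g : α → E, MemLp g (ENNReal.ofReal q) μ →
      Tendsto (fun k => ∫ x, ⟪g x, w (n k) x⟫ ∂μ) atTop
        (𝓝 (∫ x, ⟪g x, hw0.toLp w0 x⟫ ∂μ)) := by
    intro g hg
    have h1 := ((WeakDual.eval_continuous (hg.toLp g)).tendsto l).comp hl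
    have e1 : ∀ v : Lp E (ENNReal.ofReal p) μ,
        ∫ x, ⟪(hg.toLp g) x, v x⟫ ∂μ = ∫ x, ⟪g x, v x⟫ ∂μ := fun v => by
      refine integral_congr_ae ?_
      filter_upwards [hg.coeFn_toLp] with x hx
      rw [hx]
    have e2 : l (hg.toLp g) = ∫ x, ⟪g x, hw0.toLp w0 x⟫ ∂μ := by
      refine (hrep (hg.toLp g)).trans (integral_congr_ae ?_)
      filter_upwards [hg.coeFn_toLp, hw0.coeFn_toLp] with x hx hx'
      rw [hx, hx', real_inner_comm]
    rw [e2] at h1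
    refine h1.congr fun k => ?_
    rw [← e1, ← hTe]
    rfl
  refine ⟨n, hn, hw0.toLp w0, ?_, hconv⟩
  by_contra hnot
  obtain ⟨f, r, hf, hfS⟩ := geometric_hahn_banach_point_closed hSx hSc hnot
  obtain ⟨g, hg, hgrep⟩ := exists_memLp_forall_eq_integral hpq f
  have h1 := ge_of_tendsto' (hconv g hg) (b := r) fun k => by
    rw [← hgrep]
    exact (hfS _ (hw _)).le
  rw [← hgrep] at h1
  linarith

end Riesz

section Compactness

theorem exists_subseq_forall_ae_tendsto_zero {α : Type*} [MeasurableSpace α] {μ : Measure α}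
    {g : ℕ → ℕ → α → ℝ≥0∞} (hm : ∀ m k, AEMeasurable (g m k) μ)
    (h : ∀ m, Tendsto (fun k => ∫⁻ x, g m k x ∂μ) atTop (𝓝 0)) :
    ∃ n : ℕ → ℕ, StrictMono n ∧
      ∀ᵐ x ∂μ, ∀ m, Tendsto (fun j => g m (n j) x) atTop (𝓝 0) := by
  have hev : ∀ j : ℕ, ∀ᶠ k in atTop, ∀ m ≤ j, ∫⁻ x, g m k x ∂μ ≤ (1 / 2 : ℝ≥0∞) ^ j := fun j =>
    (eventually_all_finite (Set.finite_le_nat j)).2 fun m _ =>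
      ENNReal.tendsto_nhds_zero.1 (h m) _ (ENNReal.pow_pos (by norm_num) j)
  obtain ⟨n, hn, hle⟩ := extraction_forall_of_eventually hev
  refine ⟨n, hn, ae_all_iff.2 fun m => ?_⟩
  have hsum : ∫⁻ x, ∑' j, g m (n (j + m)) x ∂μ ≠ ∞ := by
    rw [lintegral_tsum fun j => hm _ _]
    refine ne_top_of_le_ne_top (b := ∑' j : ℕ, (1 / 2 : ℝ≥0∞) ^ j) ?_
      (ENNReal.tsum_le_tsum fun j => ?_)
    · rw [ENNReal.tsum_geometric]
      norm_num
    · exact (hle (j + m) m (by lia)).trans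
        (pow_le_pow_of_le_one (by simp) (by norm_num) (by lia))
  filter_upwards [ae_lt_top' (AEMeasurable.tsum fun j => hm _ _) hsum] with x hx
  exact (tendsto_add_atTop_iff_nat m).1 (ENNReal.tendsto_atTop_zero_of_tsum_ne_top hx.ne)

theorem lintegral_rpow_le_of_isProbabilityMeasure {α : Type*} [MeasurableSpace α] {ν : Measure α}
    [IsProbabilityMeasure ν] {p : ℝ} (hp : 1 < p) {g : α → ℝ≥0∞} (hg : AEMeasurable g ν) :
    (∫⁻ x, g x ∂ν) ^ p ≤ ∫⁻ x, g x ^ p ∂ν := by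
  have h := ENNReal.lintegral_mul_le_Lp_mul_Lq ν (Real.HolderConjugate.conjExponent hp) hg
    (aemeasurable_const (b := (1 : ℝ≥0∞)))
  simp only [Pi.mul_apply, mul_one, ENNReal.one_rpow, lintegral_const, measure_univ] at h
  calc (∫⁻ x, g x ∂ν) ^ p ≤ ((∫⁻ x, g x ^ p ∂ν) ^ (1 / p)) ^ p := by gcongr
    _ = _ := by rw [← ENNReal.rpow_mul, one_div, inv_mul_cancel₀ (by linarith), ENNReal.rpow_one]

variable {F : Type*} [NormedAddCommGroup F] [NormedSpace ℝ F] [MeasurableSpace F]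
  [BorelSpace F] [FiniteDimensional ℝ F] {μ : Measure F} [μ.IsAddHaarMeasure]

theorem lintegral_enorm_translate_sub_rpow_le {p : ℝ} (hp : 1 < p) {z : F → ℝ}
    (hz : ContDiff ℝ 1 z) (h : F) :
    ∫⁻ x, ‖z (x + h) - z x‖ₑ ^ p ∂μ ≤ ‖h‖ₑ ^ p * ∫⁻ x, ‖fderiv ℝ z x‖ₑ ^ p ∂μ := by
  have hD : Continuous (fderiv ℝ z) := hz.continuous_fderiv one_ne_zero
  have hp0 : 0 ≤ p := by linarith
  have : IsProbabilityMeasure (volume.restrict (Set.Ioc (0 : ℝ) 1)) := ⟨by simp⟩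
  have key : ∀ x, ‖z (x + h) - z x‖ₑ ^ p ≤
      ∫⁻ t in Set.Ioc (0 : ℝ) 1, ‖fderiv ℝ z (x + t • h)‖ₑ ^ p * ‖h‖ₑ ^ p := fun x => by
    have hder : ∀ t ∈ Set.uIcc (0 : ℝ) 1,
        HasDerivAt (fun t : ℝ => z (x + t • h)) (fderiv ℝ z (x + t • h) h) t := fun t _ => by
      have h1 : HasDerivAt (fun t : ℝ => x + t • h) h t := by
        simpa using ((hasDerivAt_id t).smul_const h).const_add x
      exact ((hz.differentiable one_ne_zero _).hasFDerivAt).comp_hasDerivAt t h1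
    have hzint : IntervalIntegrable (fun t : ℝ => fderiv ℝ z (x + t • h) h) volume 0 1 :=
      Continuous.intervalIntegrable (by fun_prop) _ _
    have h2 := intervalIntegral.integral_eq_sub_of_hasDerivAt hder hzint
    simp only [one_smul, zero_smul, add_zero] at h2
    rw [← h2, intervalIntegral.integral_of_le zero_le_one]
    calc _ ≤ (∫⁻ t in Set.Ioc (0 : ℝ) 1, ‖fderiv ℝ z (x + t • h)‖ₑ * ‖h‖ₑ) ^ p := by
          gcongr
          refine (enorm_integral_le_lintegral_enorm _).trans (lintegral_mono fun t => ?_)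
          exact ContinuousLinearMap.le_opENorm _ _
      _ ≤ _ := by
          refine (lintegral_rpow_le_of_isProbabilityMeasure hp ?_).trans_eq ?_
          · exact (Continuous.aemeasurable (by fun_prop)).mul_const _
          · simp only [ENNReal.mul_rpow_of_nonneg _ _ hp0]
  calc _ ≤ ∫⁻ x, ∫⁻ t in Set.Ioc (0 : ℝ) 1, ‖fderiv ℝ z (x + t • h)‖ₑ ^ p * ‖h‖ₑ ^ p ∂volume ∂μ :=
        lintegral_mono key
    _ = ∫⁻ t in Set.Ioc (0 : ℝ) 1, ∫⁻ x, ‖fderiv ℝ z (x + t • h)‖ₑ ^ p * ‖h‖ₑ ^ p ∂μ := by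
        refine lintegral_lintegral_swap ?_
        refine Measurable.aemeasurable ?_
        refine Measurable.mul_const (Measurable.pow_const ?_ _) _
        exact Continuous.measurable (by fun_prop)
    _ = ∫⁻ t in Set.Ioc (0 : ℝ) 1, ‖h‖ₑ ^ p * ∫⁻ x, ‖fderiv ℝ z x‖ₑ ^ p ∂μ := by
        refine lintegral_congr fun t => ?_
        rw [lintegral_add_right_eq_self (fun y => ‖fderiv ℝ z y‖ₑ ^ p * ‖h‖ₑ ^ p) (t • h),
          lintegral_mul_const, mul_comm]
        exact Measurable.pow_const (Continuous.measurable (by fun_prop)) _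
    _ = _ := by simp

theorem lintegral_enorm_sub_mean_rpow_le {p : ℝ} (hp : 1 < p) {z : F → ℝ}
    (hz : ContDiff ℝ 1 z) (hzc : HasCompactSupport z) {ν : Measure F} [IsProbabilityMeasure ν]
    {δ : ℝ} (hν : ∀ᵐ h ∂ν, ‖h‖ ≤ δ) :
    ∫⁻ x, ‖z x - ∫ h, z (x + h) ∂ν‖ₑ ^ p ∂μ ≤
      ENNReal.ofReal δ ^ p * ∫⁻ x, ‖fderiv ℝ z x‖ₑ ^ p ∂μ := by
  have hp0 : 0 ≤ p := by linarith
  have hc := hz.continuous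
  obtain ⟨C, hC⟩ := hc.bounded_above_of_compact_support hzc
  have hzint : ∀ x, Integrable (fun h => z (x + h)) ν := fun x =>
    Integrable.of_bound (Continuous.aestronglyMeasurable (by fun_prop)) C
      (Eventually.of_forall fun h => hC _)
  calc ∫⁻ x, ‖z x - ∫ h, z (x + h) ∂ν‖ₑ ^ p ∂μ
      ≤ ∫⁻ x, ∫⁻ h, ‖z (x + h) - z x‖ₑ ^ p ∂ν ∂μ := by
        refine lintegral_mono fun x => ?_
        refine le_trans ?_ (lintegral_rpow_le_of_isProbabilityMeasure hp
          (Continuous.aemeasurable (by fun_prop)))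
        gcongr
        have e : z x - ∫ h, z (x + h) ∂ν = - ∫ h, (z (x + h) - z x) ∂ν := by
          rw [integral_sub (hzint x) (integrable_const _)]
          simp
        rw [e, enorm_neg]
        exact enorm_integral_le_lintegral_enorm _
    _ = ∫⁻ h, ∫⁻ x, ‖z (x + h) - z x‖ₑ ^ p ∂μ ∂ν := by
        refine lintegral_lintegral_swap ?_
        refine Measurable.aemeasurable (Measurable.pow_const ?_ _)
        exact Continuous.measurable (by fun_prop)
    _ ≤ ∫⁻ _, ENNReal.ofReal δ ^ p * ∫⁻ x, ‖fderiv ℝ z x‖ₑ ^ p ∂μ ∂ν := by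
        refine lintegral_mono_ae ?_
        filter_upwards [hν] with h hh
        refine (lintegral_enorm_translate_sub_rpow_le hp hz h).trans ?_
        gcongr
        rw [← ofReal_norm]
        exact ENNReal.ofReal_le_ofReal hh
    _ = _ := by simp

theorem tendsto_setLIntegral_ball_rpow {p : ℝ} (hp : 1 < p) {z : ℕ → F → ℝ}
    (hz : ∀ k, ContDiff ℝ 1 (z k)) (hzc : ∀ k, HasCompactSupport (z k)) {M : ℝ≥0∞} (hM : M ≠ ∞)
    (hM0 : ∀ k, ∫⁻ x, ‖z k x‖ₑ ^ p ∂μ ≤ M) (hM1 : ∀ k, ∫⁻ x, ‖fderiv ℝ (z k) x‖ₑ ^ p ∂μ ≤ M)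
    (hw : ∀ x : F, ∀ δ : ℝ, 0 < δ →
      Tendsto (fun k => ∫ y in Metric.ball x δ, z k y ∂μ) atTop (𝓝 0)) (R : ℝ) :
    Tendsto (fun k => ∫⁻ x in Metric.ball 0 R, ‖z k x‖ₑ ^ p ∂μ) atTop (𝓝 0) := by
  have hp0 : 0 < p := by linarith
  have hmean : ∀ δ : ℝ, 0 < δ → ∃ a : ℕ → F → ℝ,
      (∀ k, ∫⁻ x, ‖z k x - a k x‖ₑ ^ p ∂μ ≤ ENNReal.ofReal δ ^ p * M) ∧
      Tendsto (fun k => ∫⁻ x in Metric.ball 0 R, ‖a k x‖ₑ ^ p ∂μ) atTop (𝓝 0) ∧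
      ∀ k, Measurable (a k) := by
    intro δ hδ
    have hB0 : μ (Metric.ball 0 δ) ≠ 0 := (Metric.measure_ball_pos μ 0 hδ).ne'
    have hB1 : μ (Metric.ball 0 δ) ≠ ∞ := measure_ball_lt_top.ne
    set ν : Measure F := (μ (Metric.ball 0 δ))⁻¹ • μ.restrict (Metric.ball 0 δ) with hνdef
    have hνp : IsProbabilityMeasure ν := ⟨by simp [hνdef, ENNReal.inv_mul_cancel hB0 hB1]⟩
    have hν : ∀ᵐ h ∂ν, ‖h‖ ≤ δ := by
      refine Measure.ae_smul_measure ?_ _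
      filter_upwards [ae_restrict_mem Metric.isOpen_ball.measurableSet] with h hh
      exact (mem_ball_zero_iff.1 hh).le
    refine ⟨fun k x => ∫ h, z k (x + h) ∂ν, fun k => ?_, ?_, fun k => ?_⟩
    · exact (lintegral_enorm_sub_mean_rpow_le hp (hz k) (hzc k) hν).trans
        (by gcongr; exact hM1 k)
    · have hmeas : ∀ k, Measurable (fun x => ∫ h, z k (x + h) ∂ν) := fun k =>
        (StronglyMeasurable.integral_prod_right (f := fun x h => z k (x + h))
          (Continuous.stronglyMeasurable (by have := (hz k).continuous; fun_prop))).measurable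
      have hb : ∀ k x, ‖∫ h, z k (x + h) ∂ν‖ₑ ^ p ≤ (μ (Metric.ball 0 δ))⁻¹ * M := fun k x => by
        calc ‖∫ h, z k (x + h) ∂ν‖ₑ ^ p ≤ (∫⁻ h, ‖z k (x + h)‖ₑ ∂ν) ^ p := by
              gcongr
              exact enorm_integral_le_lintegral_enorm _
          _ ≤ ∫⁻ h, ‖z k (x + h)‖ₑ ^ p ∂ν := lintegral_rpow_le_of_isProbabilityMeasure hp
              (Continuous.aemeasurable (by have := (hz k).continuous; fun_prop))
          _ ≤ (μ (Metric.ball 0 δ))⁻¹ * ∫⁻ h, ‖z k (x + h)‖ₑ ^ p ∂μ := by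
              rw [hνdef, lintegral_smul_measure, smul_eq_mul]
              gcongr
              exact Measure.restrict_le_self
          _ ≤ _ := by
              rw [lintegral_add_left_eq_self (fun y => ‖z k y‖ₑ ^ p) x]
              gcongr
              exact hM0 k
      have hlim : ∀ x, Tendsto (fun k => ‖∫ h, z k (x + h) ∂ν‖ₑ ^ p) atTop (𝓝 0) := fun x => by
        have e : ∀ k, ∫ h, z k (x + h) ∂ν =
            (μ (Metric.ball 0 δ))⁻¹.toReal * ∫ y in Metric.ball x δ, z k y ∂μ := fun k => by
          rw [hνdef, integral_smul_measure, smul_eq_mul]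
          congr 1
          have h1 := (measurePreserving_add_left μ x).setIntegral_preimage_emb
            (measurableEmbedding_addLeft x) (z k) (Metric.ball x δ)
          rw [← h1, preimage_add_ball, sub_self]
        have h2 : Tendsto (fun k => ∫ h, z k (x + h) ∂ν) atTop (𝓝 0) := by
          simp only [e]
          simpa using (hw x δ hδ).const_mul ((μ (Metric.ball 0 δ))⁻¹.toReal)
        have h3 := ((ENNReal.continuous_rpow_const (y := p)).comp continuous_enorm).tendsto (0 : ℝ)
        simp only [Function.comp_apply, enorm_zero, ENNReal.zero_rpow_of_pos hp0] at h3
        exact h3.comp h2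
      have h4 := tendsto_lintegral_of_dominated_convergence (μ := μ.restrict (Metric.ball 0 R))
        (F := fun k x => ‖∫ h, z k (x + h) ∂ν‖ₑ ^ p) (f := fun _ => 0)
        (fun _ => (μ (Metric.ball 0 δ))⁻¹ * M) (fun k => (hmeas k).enorm.pow_const _)
        (fun k => Eventually.of_forall (hb k))
        (by
          rw [lintegral_const, Measure.restrict_apply_univ]
          exact ENNReal.mul_ne_top (ENNReal.mul_ne_top (ENNReal.inv_ne_top.2 hB0) hM)
            measure_ball_lt_top.ne)
        (Eventually.of_forall hlim)
      simpa using h4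
    · exact (StronglyMeasurable.integral_prod_right (f := fun x h => z k (x + h))
        (Continuous.stronglyMeasurable (by have := (hz k).continuous; fun_prop))).measurable
  refine ENNReal.tendsto_nhds_zero.2 fun e he => ?_
  have hsmall : Tendsto (fun δ : ℝ => (2 : ℝ≥0∞) ^ (p - 1) * (ENNReal.ofReal δ ^ p * M))
      (𝓝[>] 0) (𝓝 0) := by
    have h1 : Tendsto (fun δ : ℝ => ENNReal.ofReal δ ^ p) (𝓝[>] 0) (𝓝 0) := by
      have h := ((ENNReal.continuous_rpow_const (y := p)).comp ENNReal.continuous_ofReal).tendsto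
        (0 : ℝ)
      simp only [Function.comp_apply, ENNReal.ofReal_zero, ENNReal.zero_rpow_of_pos hp0] at h
      exact h.mono_left nhdsWithin_le_nhds
    have h2 := ENNReal.Tendsto.mul_const h1 (Or.inr hM)
    have h3 := ENNReal.Tendsto.const_mul (a := (2 : ℝ≥0∞) ^ (p - 1)) h2
      (Or.inr (ENNReal.rpow_ne_top_of_nonneg (by linarith) (by norm_num)))
    simpa using h3
  obtain ⟨δ, hδe, hδ⟩ := ((ENNReal.tendsto_nhds_zero.1 hsmall (e / 2)
    (ENNReal.half_pos he.ne')).and self_mem_nhdsWithin).exists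
  obtain ⟨a, ha1, ha2, ham⟩ := hmean δ hδ
  have ha3 := ENNReal.Tendsto.const_mul (a := (2 : ℝ≥0∞) ^ (p - 1)) ha2
      (Or.inr (ENNReal.rpow_ne_top_of_nonneg (by linarith) (by norm_num)))
  rw [mul_zero] at ha3
  filter_upwards [ENNReal.tendsto_nhds_zero.1 ha3 (e / 2) (ENNReal.half_pos he.ne')] with k hk
  calc ∫⁻ x in Metric.ball 0 R, ‖z k x‖ₑ ^ p ∂μ
      ≤ ∫⁻ x in Metric.ball 0 R, ((2 : ℝ≥0∞) ^ (p - 1) * ‖z k x - a k x‖ₑ ^ p +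
          (2 : ℝ≥0∞) ^ (p - 1) * ‖a k x‖ₑ ^ p) ∂μ := by
        refine lintegral_mono fun x => ?_
        rw [← mul_add]
        refine le_trans ?_ (ENNReal.rpow_add_le_mul_rpow_add_rpow _ _ hp.le)
        gcongr
        simpa using enorm_add_le (z k x - a k x) (a k x)
    _ = (2 : ℝ≥0∞) ^ (p - 1) * (∫⁻ x in Metric.ball 0 R, ‖z k x - a k x‖ₑ ^ p ∂μ) +
          (2 : ℝ≥0∞) ^ (p - 1) * ∫⁻ x in Metric.ball 0 R, ‖a k x‖ₑ ^ p ∂μ := by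
        have hzm : Measurable (z k) := (hz k).continuous.measurable
        have hak := ham k
        rw [lintegral_add_right _ (((ham k).enorm.pow_const _).const_mul _),
          lintegral_const_mul _ (by fun_prop),
          lintegral_const_mul _ ((ham k).enorm.pow_const _)]
    _ ≤ e / 2 + e / 2 := by
        refine add_le_add (le_trans ?_ hδe) hk
        gcongr
        exact (lintegral_mono' Measure.restrict_le_self le_rfl).trans (ha1 k)
    _ = e := ENNReal.add_halves e

end Compactness

section TestFunctions

variable {N : ℕ} {Ω : Set (Euc N)}

theorem gradient_eq_toDual_symm (ζ : Euc N → ℝ) (x : Euc N) :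
    gradient ζ x = (InnerProductSpace.toDual ℝ (Euc N)).symm (fderiv ℝ ζ x) := rfl

theorem norm_gradient (ζ : Euc N → ℝ) (x : Euc N) : ‖gradient ζ x‖ = ‖fderiv ℝ ζ x‖ := by
  rw [gradient_eq_toDual_symm, LinearIsometryEquiv.norm_map]

namespace IsTestFun

theorem differentiable {ζ : Euc N → ℝ} (h : IsTestFun Ω ζ) : Differentiable ℝ ζ :=
  h.1.differentiable (by simp)

theorem continuous {ζ : Euc N → ℝ} (h : IsTestFun Ω ζ) : Continuous ζ := h.1.continuous

theorem continuous_gradient {ζ : Euc N → ℝ} (h : IsTestFun Ω ζ) : Continuous (gradient ζ) :=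
  (InnerProductSpace.toDual ℝ (Euc N)).symm.continuous.comp (h.1.continuous_fderiv (by simp))

theorem hasCompactSupport_gradient {ζ : Euc N → ℝ} (h : IsTestFun Ω ζ) :
    HasCompactSupport (gradient ζ) :=
  (h.2.1.fderiv (𝕜 := ℝ)).comp_left (g := (InnerProductSpace.toDual ℝ (Euc N)).symm) (map_zero _)

theorem memLp {ζ : Euc N → ℝ} (h : IsTestFun Ω ζ) (P : ℝ≥0∞) :
    MemLp ζ P (volume.restrict Ω) :=
  h.continuous.memLp_of_hasCompactSupport h.2.1

theorem memLp_gradient {ζ : Euc N → ℝ} (h : IsTestFun Ω ζ) (P : ℝ≥0∞) :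
    MemLp (gradient ζ) P (volume.restrict Ω) :=
  h.continuous_gradient.memLp_of_hasCompactSupport h.hasCompactSupport_gradient

theorem lin {ζ η : Euc N → ℝ} (hζ : IsTestFun Ω ζ) (hη : IsTestFun Ω η) (a b : ℝ) :
    IsTestFun Ω (fun x => a * ζ x + b * η x) := by
  refine ⟨(contDiff_const.mul hζ.1).add (contDiff_const.mul hη.1),
    hζ.2.1.mul_left.add hη.2.1.mul_left, ?_⟩
  refine (tsupport_add _ _).trans (Set.union_subset ?_ ?_)
  · exact (tsupport_mul_subset_right (f := fun _ => a)).trans hζ.2.2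
  · exact (tsupport_mul_subset_right (f := fun _ => b)).trans hη.2.2

theorem sub {ζ η : Euc N → ℝ} (hζ : IsTestFun Ω ζ) (hη : IsTestFun Ω η) :
    IsTestFun Ω (fun x => ζ x - η x) := by
  simpa [sub_eq_add_neg] using hζ.lin hη 1 (-1)

theorem mul {ζ g : Euc N → ℝ} (hζ : IsTestFun Ω ζ) (hg : ContDiff ℝ (⊤ : ℕ∞) g) :
    IsTestFun Ω (fun x => ζ x * g x) :=
  ⟨hζ.1.mul hg, hζ.2.1.mul_right, tsupport_mul_subset_left.trans hζ.2.2⟩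

theorem zero : IsTestFun Ω (fun _ => (0 : ℝ)) :=
  ⟨contDiff_const, HasCompactSupport.zero, by
    have : tsupport (fun _ : Euc N => (0 : ℝ)) = ∅ := tsupport_eq_empty_iff.2 rfl
    rw [this]
    exact Set.empty_subset _⟩

theorem gradient_lin {ζ η : Euc N → ℝ} (hζ : IsTestFun Ω ζ) (hη : IsTestFun Ω η) (a b : ℝ)
    (x : Euc N) :
    gradient (fun x => a * ζ x + b * η x) x = a • gradient ζ x + b • gradient η x := by
  have h := ((hζ.differentiable x).hasFDerivAt.const_mul a).add
    ((hη.differentiable x).hasFDerivAt.const_mul b)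
  have h' : fderiv ℝ (fun x => a * ζ x + b * η x) x = a • fderiv ℝ ζ x + b • fderiv ℝ η x :=
    h.fderiv
  simp only [gradient_eq_toDual_symm, h', map_add, map_smul]

theorem gradient_sub {ζ η : Euc N → ℝ} (hζ : IsTestFun Ω ζ) (hη : IsTestFun Ω η) (x : Euc N) :
    gradient (fun x => ζ x - η x) x = gradient ζ x - gradient η x := by
  have h := hζ.gradient_lin hη 1 (-1) x
  simpa [sub_eq_add_neg] using h

theorem gradient_mul_arctan {ψ z : Euc N → ℝ} (hψ : IsTestFun Ω ψ) (hz : IsTestFun Ω z)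
    (x : Euc N) :
    gradient (fun x => ψ x * Real.arctan (z x)) x =
      (ψ x / (1 + z x ^ 2)) • gradient z x + Real.arctan (z x) • gradient ψ x := by
  have h := (hψ.differentiable x).hasFDerivAt.mul (hz.differentiable x).hasFDerivAt.arctan
  have h' : fderiv ℝ (fun x => ψ x * Real.arctan (z x)) x =
      ψ x • (1 / (1 + z x ^ 2)) • fderiv ℝ z x + Real.arctan (z x) • fderiv ℝ ψ x :=
    h.fderiv
  simp only [gradient_eq_toDual_symm, h', map_add, map_smul, smul_smul, mul_one_div]

theorem setIntegral_eq {ζ : Euc N → ℝ} (hζ : IsTestFun Ω ζ) {g : Euc N → ℝ}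
    (hg : ∀ x, ζ x = 0 → g x = 0) : ∫ x in Ω, g x = ∫ x, g x := by
  refine setIntegral_eq_integral_of_forall_compl_eq_zero fun x hx => hg x ?_
  by_contra h
  exact hx (hζ.2.2 (subset_tsupport _ h))

theorem integral_mul_fderiv {ζ φ : Euc N → ℝ} (hζ : IsTestFun Ω ζ) (hφ : IsTestFun Ω φ)
    (e : Euc N) :
    ∫ x in Ω, φ x * fderiv ℝ ζ x e = - ∫ x in Ω, ⟪gradient φ x, e⟫ * ζ x := by
  have hfe : ∀ {χ : Euc N → ℝ}, IsTestFun Ω χ → Continuous fun x => fderiv ℝ χ x e := fun hχ =>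
    (hχ.1.continuous_fderiv (by simp)).clm_apply continuous_const
  rw [hφ.setIntegral_eq (fun x hx => by simp [hx]), hζ.setIntegral_eq (fun x hx => by simp [hx]),
    integral_mul_fderiv_eq_neg_fderiv_mul_of_integrable]
  · congr 2
    ext x
    rw [gradient_eq_toDual_symm, InnerProductSpace.toDual_symm_apply]
  · exact ((hfe hφ).mul hζ.continuous).integrable_of_hasCompactSupport hζ.2.1.mul_left
  · exact (hφ.continuous.mul (hfe hζ)).integrable_of_hasCompactSupport hφ.2.1.mul_right
  · exact (hφ.continuous.mul hζ.continuous).integrable_of_hasCompactSupport hζ.2.1.mul_left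
  · exact fun x _ => hφ.differentiable x
  · exact fun x _ => hζ.differentiable x

end IsTestFun

end TestFunctions

/-- `u` belongs to the closure of the test functions in the Sobolev norm, with gradient `v`. -/
def IsSobolevZero {N : ℕ} (p : ℝ) (Ω : Set (Euc N)) (u : Euc N → ℝ) (v : Euc N → Euc N) : Prop :=
  MemLp u (ENNReal.ofReal p) (volume.restrict Ω) ∧
  MemLp v (ENNReal.ofReal p) (volume.restrict Ω) ∧
  ∃ φ : ℕ → Euc N → ℝ, (∀ j, IsTestFun Ω (φ j)) ∧
    Tendsto (fun j => ∫ x in Ω, ‖φ j x - u x‖ ^ p) atTop (𝓝 0) ∧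
    Tendsto (fun j => ∫ x in Ω, ‖gradient (φ j) x - v x‖ ^ p) atTop (𝓝 0)

section Jets

variable {N : ℕ} {Ω : Set (Euc N)} {p q : ℝ}

/-- The space of values of a function together with its gradient. -/
abbrev JetSpace (N : ℕ) : Type := WithLp 2 (ℝ × Euc N)

theorem JetSpace.norm_fst_le (w : JetSpace N) : ‖w.fst‖ ≤ ‖w‖ :=
  WithLp.norm_fst_le _ w

theorem JetSpace.norm_snd_le (w : JetSpace N) : ‖w.snd‖ ≤ ‖w‖ :=
  WithLp.norm_snd_le _ w

theorem JetSpace.norm_rpow_le (hp : 1 < p) (w : JetSpace N) :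
    ‖w‖ ^ p ≤ 2 ^ p * (‖w.fst‖ ^ p + ‖w.snd‖ ^ p) := by
  have h := norm_add_rpow_le hp (WithLp.toLp 2 (w.fst, (0 : Euc N)) : JetSpace N)
    (WithLp.toLp 2 ((0 : ℝ), w.snd))
  have e : (WithLp.toLp 2 (w.fst, (0 : Euc N)) : JetSpace N) + WithLp.toLp 2 ((0 : ℝ), w.snd)
      = w := by
    rw [← WithLp.toLp_add]
    simp
    rfl
  rwa [e, WithLp.norm_toLp_fst, WithLp.norm_toLp_snd] at h

/-- The function `x ↦ (ζ x, ∇ζ x)`. -/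
def jet (ζ : Euc N → ℝ) (x : Euc N) : JetSpace N := WithLp.toLp 2 (ζ x, gradient ζ x)

theorem IsTestFun.memLp_jet {ζ : Euc N → ℝ} (h : IsTestFun Ω ζ) (P : ℝ≥0∞) :
    MemLp (jet ζ) P (volume.restrict Ω) := by
  have hc : Continuous (jet ζ) := (WithLp.prod_continuous_toLp 2 ℝ (Euc N)).comp
    (h.continuous.prodMk h.continuous_gradient)
  refine hc.memLp_of_hasCompactSupport ?_
  refine HasCompactSupport.intro (h.2.1.isCompact.union h.hasCompactSupport_gradient.isCompact)
    fun x hx => ?_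
  rw [Set.mem_union, not_or] at hx
  simp [jet, image_eq_zero_of_notMem_tsupport hx.1, image_eq_zero_of_notMem_tsupport hx.2]

/-- The vector space of test functions. -/
def testSubmodule (Ω : Set (Euc N)) : Submodule ℝ (Euc N → ℝ) where
  carrier := {ζ | IsTestFun Ω ζ}
  add_mem' {ζ η} hζ hη := by
    have h := IsTestFun.lin (Ω := Ω) (ζ := ζ) (η := η) hζ hη 1 1
    simp only [one_mul] at h
    exact h
  zero_mem' := IsTestFun.zero
  smul_mem' c ζ hζ := by
    have h := IsTestFun.lin (Ω := Ω) (ζ := ζ) (η := ζ) hζ hζ c 0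
    simp only [zero_mul, add_zero] at h
    exact h

theorem jet_lin {ζ η : Euc N → ℝ} (hζ : IsTestFun Ω ζ) (hη : IsTestFun Ω η) (a b : ℝ) :
    jet (fun x => a * ζ x + b * η x) = a • jet ζ + b • jet η := by
  funext x
  simp only [jet, hζ.gradient_lin hη]
  rfl

/-- The linear map sending a test function to the class of its jet. -/
def jetLp (p : ℝ) (Ω : Set (Euc N)) :
    testSubmodule Ω →ₗ[ℝ] Lp (JetSpace N) (ENNReal.ofReal p) (volume.restrict Ω) where
  toFun ζ := (IsTestFun.memLp_jet ζ.2 _).toLp (jet ζ.1)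
  map_add' ζ η := by
    rw [← MemLp.toLp_add]
    refine MemLp.toLp_congr _ _ (Eventually.of_forall fun x => ?_)
    have h := congrFun (jet_lin ζ.2 η.2 1 1) x
    simp only [one_mul, one_smul] at h
    exact h
  map_smul' c ζ := by
    rw [RingHom.id_apply, ← MemLp.toLp_const_smul]
    refine MemLp.toLp_congr _ _ (Eventually.of_forall fun x => ?_)
    have h := congrFun (jet_lin ζ.2 ζ.2 c 0) x
    simp only [zero_mul, add_zero, zero_smul] at h
    exact h

theorem coeFn_jetLp (ζ : testSubmodule Ω) :
    jetLp p Ω ζ =ᵐ[volume.restrict Ω] jet ζ.1 :=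
  MemLp.coeFn_toLp (IsTestFun.memLp_jet ζ.2 _)

theorem jetLp_norm_rpow (hp : 1 < p) (ζ : testSubmodule Ω) :
    ‖jetLp p Ω ζ‖ ^ p = ∫ x in Ω, ‖jet ζ.1 x‖ ^ p := by
  rw [Lp_norm_rpow hp]
  refine integral_congr_ae ?_
  filter_upwards [coeFn_jetLp ζ] with x hx
  rw [hx]

theorem jetLp_norm_rpow_le (hp : 1 < p) (ζ : testSubmodule Ω) :
    ‖jetLp p Ω ζ‖ ^ p ≤
      2 ^ p * ((∫ x in Ω, ‖ζ.1 x‖ ^ p) + ∫ x in Ω, ‖gradient ζ.1 x‖ ^ p) := by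
  have h0 := (IsTestFun.memLp ζ.2 _).integrable_rpow hp
  have h1 := (IsTestFun.memLp_gradient ζ.2 _).integrable_rpow hp
  rw [jetLp_norm_rpow hp, ← integral_add h0 h1, ← integral_const_mul]
  exact integral_mono ((IsTestFun.memLp_jet ζ.2 _).integrable_rpow hp)
    ((h0.add h1).const_mul _) fun x => JetSpace.norm_rpow_le hp (jet ζ.1 x)

theorem memLp_fst {P : ℝ≥0∞} {μ : Measure (Euc N)} {w : Euc N → JetSpace N}
    (hw : MemLp w P μ) : MemLp (fun x => (w x).fst) P μ :=
  hw.mono ((WithLp.fstL 2 ℝ ℝ (Euc N)).continuous.comp_aestronglyMeasurable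
    hw.aestronglyMeasurable) (Eventually.of_forall fun _ => JetSpace.norm_fst_le _)

theorem memLp_snd {P : ℝ≥0∞} {μ : Measure (Euc N)} {w : Euc N → JetSpace N}
    (hw : MemLp w P μ) : MemLp (fun x => (w x).snd) P μ :=
  hw.mono ((WithLp.sndL 2 ℝ ℝ (Euc N)).continuous.comp_aestronglyMeasurable
    hw.aestronglyMeasurable) (Eventually.of_forall fun _ => JetSpace.norm_snd_le _)

theorem memLp_mkFst {P : ℝ≥0∞} {μ : Measure (Euc N)} {g : Euc N → ℝ} (hg : MemLp g P μ) :
    MemLp (fun x => (WithLp.toLp 2 (g x, (0 : Euc N)) : JetSpace N)) P μ :=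
  hg.mono ((WithLp.prod_continuous_toLp 2 ℝ (Euc N)).comp_aestronglyMeasurable
    (hg.aestronglyMeasurable.prodMk aestronglyMeasurable_const))
    (Eventually.of_forall fun x => by rw [WithLp.norm_toLp_fst])

theorem memLp_mkSnd {P : ℝ≥0∞} {μ : Measure (Euc N)} {g : Euc N → Euc N} (hg : MemLp g P μ) :
    MemLp (fun x => (WithLp.toLp 2 ((0 : ℝ), g x) : JetSpace N)) P μ :=
  hg.mono ((WithLp.prod_continuous_toLp 2 ℝ (Euc N)).comp_aestronglyMeasurable
    (aestronglyMeasurable_const.prodMk hg.aestronglyMeasurable))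
    (Eventually.of_forall fun x => by rw [WithLp.norm_toLp_snd])

theorem isSobolevZero_of_mem_closure (hp : 1 < p) [Fact (1 ≤ ENNReal.ofReal p)]
    {w : Lp (JetSpace N) (ENNReal.ofReal p) (volume.restrict Ω)}
    (hw : w ∈ (LinearMap.range (jetLp p Ω)).topologicalClosure) :
    IsSobolevZero p Ω (fun x => (w x).fst) (fun x => (w x).snd) := by
  refine ⟨memLp_fst (Lp.memLp w), memLp_snd (Lp.memLp w), ?_⟩
  obtain ⟨s, hs, hlim⟩ := mem_closure_iff_seq_limit.1 hw
  choose ζ hζ using hs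
  have h0 : Tendsto (fun j => ‖s j - w‖ ^ p) atTop (𝓝 0) := by
    have h1 := (tendsto_iff_norm_sub_tendsto_zero.1 hlim).rpow_const
      (p := p) (Or.inr (by linarith))
    rwa [Real.zero_rpow (by linarith)] at h1
  have e : ∀ j, ‖s j - w‖ ^ p = ∫ x in Ω, ‖jet (ζ j).1 x - w x‖ ^ p := fun j => by
    rw [Lp_norm_rpow hp]
    refine integral_congr_ae ?_
    filter_upwards [Lp.coeFn_sub (s j) w, coeFn_jetLp (p := p) (ζ j)] with x hx hx'
    rw [hx, Pi.sub_apply, ← hζ j, hx']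
  have hi : ∀ j, Integrable (fun x => ‖jet (ζ j).1 x - w x‖ ^ p) (volume.restrict Ω) := fun j =>
    ((IsTestFun.memLp_jet (ζ j).2 _).sub (Lp.memLp w)).integrable_rpow hp
  simp only [e] at h0
  refine ⟨fun j => (ζ j).1, fun j => (ζ j).2, ?_, ?_⟩
  · refine squeeze_zero (fun j => integral_nonneg fun x => by positivity) (fun j => ?_) h0
    refine integral_mono (((IsTestFun.memLp (ζ j).2 _).sub
      (memLp_fst (Lp.memLp w))).integrable_rpow hp) (hi j) fun x => ?_
    exact Real.rpow_le_rpow (norm_nonneg _) (JetSpace.norm_fst_le (jet (ζ j).1 x - w x))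
      (by linarith)
  · refine squeeze_zero (fun j => integral_nonneg fun x => by positivity) (fun j => ?_) h0
    refine integral_mono (((IsTestFun.memLp_gradient (ζ j).2 _).sub
      (memLp_snd (Lp.memLp w))).integrable_rpow hp) (hi j) fun x => ?_
    exact Real.rpow_le_rpow (norm_nonneg _) (JetSpace.norm_snd_le (jet (ζ j).1 x - w x))
      (by linarith)

/-- Weak sequential compactness of bounded sequences of test functions in the Sobolev space. -/
theorem exists_subseq_weak_limit (hpq : p.HolderConjugate q) {u : ℕ → Euc N → ℝ}
    (hu : ∀ k, IsTestFun Ω (u k)) {M : ℝ} (hM0 : ∀ k, ∫ x in Ω, ‖u k x‖ ^ p ≤ M)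
    (hM1 : ∀ k, ∫ x in Ω, ‖gradient (u k) x‖ ^ p ≤ M) :
    ∃ n : ℕ → ℕ, StrictMono n ∧ ∃ u0 v0, IsSobolevZero p Ω u0 v0 ∧
      (∀ g : Euc N → ℝ, MemLp g (ENNReal.ofReal q) (volume.restrict Ω) →
        Tendsto (fun k => ∫ x in Ω, ⟪g x, u (n k) x⟫) atTop (𝓝 (∫ x in Ω, ⟪g x, u0 x⟫))) ∧
      (∀ G : Euc N → Euc N, MemLp G (ENNReal.ofReal q) (volume.restrict Ω) →
        Tendsto (fun k => ∫ x in Ω, ⟪G x, gradient (u (n k)) x⟫) atTop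
          (𝓝 (∫ x in Ω, ⟪G x, v0 x⟫))) := by
  have hp := hpq.lt
  have hF : Fact (1 ≤ ENNReal.ofReal p) := ⟨by simpa using hp.le⟩
  have hM : 0 ≤ M := le_trans (integral_nonneg fun x => by positivity) (hM0 0)
  have hb : ∀ k, ‖jetLp p Ω ⟨u k, hu k⟩‖ ≤ (2 ^ p * (M + M)) ^ p⁻¹ := fun k => by
    rw [Real.le_rpow_inv_iff_of_pos (norm_nonneg _) (by positivity) (by linarith)]
    refine (jetLp_norm_rpow_le hp _).trans ?_
    gcongr
    exacts [hM0 k, hM1 k]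
  obtain ⟨n, hn, w0, hw0, hlim⟩ := exists_subseq_tendsto_integral_inner hpq
    (S := ((LinearMap.range (jetLp p Ω)).topologicalClosure : Set _))
    (Submodule.isClosed_topologicalClosure _) (Submodule.convex _)
    (w := fun k => jetLp p Ω ⟨u k, hu k⟩)
    (fun k => Submodule.le_topologicalClosure _ (LinearMap.mem_range_self _ _)) hb
  refine ⟨n, hn, _, _, isSobolevZero_of_mem_closure hp hw0, fun g hg => ?_, fun G hG => ?_⟩
  · refine ((hlim _ (memLp_mkFst hg)).congr fun k => integral_congr_ae ?_).trans_eq ?_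
    · filter_upwards [coeFn_jetLp (p := p) ⟨u (n k), hu (n k)⟩] with x hx
      rw [hx, WithLp.prod_inner_apply]
      simp [jet]
    · simp [WithLp.prod_inner_apply]
  · refine ((hlim _ (memLp_mkSnd hG)).congr fun k => integral_congr_ae ?_).trans_eq ?_
    · filter_upwards [coeFn_jetLp (p := p) ⟨u (n k), hu (n k)⟩] with x hx
      rw [hx, WithLp.prod_inner_apply]
      simp [jet]
    · simp [WithLp.prod_inner_apply]

/-- Bounded functionals on the test functions are given by integration. -/
theorem exists_representation (hpq : p.HolderConjugate q) {f : (Euc N → ℝ) → ℝ}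
    (hflin : ∀ (a b : ℝ) (ζ η : Euc N → ℝ), IsTestFun Ω ζ → IsTestFun Ω η →
      f (fun x => a * ζ x + b * η x) = a * f ζ + b * f η)
    {C : ℝ} (hC : 0 ≤ C)
    (hfbound : ∀ ζ : Euc N → ℝ, IsTestFun Ω ζ →
      |f ζ| ≤ C * (∫ x in Ω, (|ζ x| ^ p + ‖gradient ζ x‖ ^ p)) ^ (1 / p)) :
    ∃ (g : Euc N → ℝ) (G : Euc N → Euc N),
      MemLp g (ENNReal.ofReal q) (volume.restrict Ω) ∧
      MemLp G (ENNReal.ofReal q) (volume.restrict Ω) ∧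
      ∀ ζ, IsTestFun Ω ζ →
        f ζ = (∫ x in Ω, ⟪g x, ζ x⟫) + ∫ x in Ω, ⟪G x, gradient ζ x⟫ := by
  have hp := hpq.lt
  have hF : Fact (1 ≤ ENNReal.ofReal p) := ⟨by simpa using hp.le⟩
  let fl : testSubmodule Ω →ₗ[ℝ] ℝ :=
    { toFun := fun ζ => f ζ.1
      map_add' := fun ζ η => by
        have h := hflin 1 1 ζ.1 η.1 ζ.2 η.2
        simp only [one_mul] at h
        exact h
      map_smul' := fun c ζ => by
        have h := hflin c 0 ζ.1 ζ.1 ζ.2 ζ.2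
        simp only [zero_mul, add_zero] at h
        exact h }
  have hb : ∀ ζ, |fl ζ| ≤ C * 2 ^ (1 / p) * ‖jetLp p Ω ζ‖ := fun ζ => by
    refine (hfbound ζ.1 ζ.2).trans ?_
    rw [mul_assoc]
    refine mul_le_mul_of_nonneg_left ?_ hC
    have h0 := (IsTestFun.memLp ζ.2 _).integrable_rpow hp
    have h1 := (IsTestFun.memLp_gradient ζ.2 _).integrable_rpow hp
    have h2 : ∫ x in Ω, (|ζ.1 x| ^ p + ‖gradient ζ.1 x‖ ^ p) ≤ 2 * ‖jetLp p Ω ζ‖ ^ p := by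
      rw [jetLp_norm_rpow hp, ← integral_const_mul]
      refine integral_mono (h0.add h1)
        (((IsTestFun.memLp_jet ζ.2 _).integrable_rpow hp).const_mul _) fun x => ?_
      have h3 := Real.rpow_le_rpow (norm_nonneg _) (JetSpace.norm_fst_le (jet ζ.1 x))
        (by linarith : 0 ≤ p)
      have h4 := Real.rpow_le_rpow (norm_nonneg _) (JetSpace.norm_snd_le (jet ζ.1 x))
        (by linarith : 0 ≤ p)
      have e3 : ‖(jet ζ.1 x).fst‖ = |ζ.1 x| := rfl
      have e4 : ‖(jet ζ.1 x).snd‖ = ‖gradient ζ.1 x‖ := rfl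
      rw [e3] at h3
      rw [e4] at h4
      simp only
      linarith
    refine (Real.rpow_le_rpow (integral_nonneg fun x => by positivity) h2
      (by positivity)).trans_eq ?_
    rw [Real.mul_rpow (by norm_num) (by positivity), one_div,
      Real.rpow_rpow_inv (norm_nonneg _) (by linarith)]
  have hker : LinearMap.ker (jetLp p Ω) ≤ LinearMap.ker fl := fun ζ hζ => by
    have h := hb ζ
    rw [LinearMap.mem_ker.1 hζ, norm_zero, mul_zero] at h
    exact LinearMap.mem_ker.2 (abs_nonpos_iff.1 h)
  let gl : LinearMap.range (jetLp p Ω) →ₗ[ℝ] ℝ :=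
    ((LinearMap.ker (jetLp p Ω)).liftQ fl hker).comp (jetLp p Ω).quotKerEquivRange.symm.toLinearMap
  have hgl : ∀ ζ (h : jetLp p Ω ζ ∈ LinearMap.range (jetLp p Ω)), gl ⟨jetLp p Ω ζ, h⟩ = fl ζ :=
    fun ζ h => by
      simp only [gl, LinearMap.comp_apply, LinearEquiv.coe_coe,
        LinearMap.quotKerEquivRange_symm_apply_image]
      exact Submodule.liftQ_apply _ _ _
  have hglb : ∀ w, ‖gl w‖ ≤ C * 2 ^ (1 / p) * ‖w‖ := by
    rintro ⟨w, hw⟩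
    obtain ⟨ζ, rfl⟩ := LinearMap.mem_range.1 hw
    rw [hgl]
    exact hb ζ
  obtain ⟨L, hL, -⟩ := exists_extension_norm_eq (LinearMap.range (jetLp p Ω))
    (gl.mkContinuous _ hglb)
  obtain ⟨H, hH, hrep⟩ := exists_memLp_forall_eq_integral hpq L
  refine ⟨_, _, memLp_fst hH, memLp_snd hH, fun ζ hζ => ?_⟩
  have h1 := hL ⟨jetLp p Ω ⟨ζ, hζ⟩, LinearMap.mem_range_self _ _⟩
  rw [LinearMap.mkContinuous_apply, hgl, hrep] at h1
  rw [← integral_add (integrable_inner_of_memLp hpq (memLp_fst hH) (hζ.memLp _))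
    (integrable_inner_of_memLp hpq (memLp_snd hH) (hζ.memLp_gradient _))]
  refine h1.symm.trans (integral_congr_ae ?_)
  filter_upwards [coeFn_jetLp (p := p) ⟨ζ, hζ⟩] with x hx
  rw [hx, WithLp.prod_inner_apply]
  rfl

end Jets

theorem exists_subseq_forall_ae_tendsto_zero_real {α : Type*} [MeasurableSpace α] {μ : Measure α}
    {g : ℕ → ℕ → α → ℝ} (hi : ∀ m k, Integrable (g m k) μ) (h0 : ∀ m k x, 0 ≤ g m k x)
    (h : ∀ m, Tendsto (fun k => ∫ x, g m k x ∂μ) atTop (𝓝 0)) :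
    ∃ n : ℕ → ℕ, StrictMono n ∧
      ∀ᵐ x ∂μ, ∀ m, Tendsto (fun j => g m (n j) x) atTop (𝓝 0) := by
  obtain ⟨n, hn, hx⟩ := exists_subseq_forall_ae_tendsto_zero (μ := μ)
    (g := fun m k x => ENNReal.ofReal (g m k x))
    (fun m k => (hi m k).aestronglyMeasurable.aemeasurable.ennreal_ofReal) fun m => by
      simp_rw [← ofReal_integral_eq_lintegral_ofReal (hi m _)
        (Eventually.of_forall (h0 m _))]
      simpa using ENNReal.tendsto_ofReal (h m)
  refine ⟨n, hn, ?_⟩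
  filter_upwards [hx] with x hx m
  have h1 := (ENNReal.tendsto_toReal ENNReal.zero_ne_top).comp (hx m)
  simpa [Function.comp_def, ENNReal.toReal_ofReal (h0 _ _ _)] using h1

theorem tendsto_of_norm_sub_rpow {E : Type*} [NormedAddCommGroup E] {p : ℝ} (hp : 1 < p)
    {a : ℕ → E} {b : E} (h : Tendsto (fun k => ‖a k - b‖ ^ p) atTop (𝓝 0)) :
    Tendsto a atTop (𝓝 b) := by
  rw [tendsto_iff_norm_sub_tendsto_zero]
  have h1 := h.rpow_const (p := p⁻¹) (Or.inr (inv_nonneg.2 (by linarith)))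
  rw [Real.zero_rpow (inv_ne_zero (by linarith))] at h1
  exact h1.congr fun k => Real.rpow_rpow_inv (norm_nonneg _) (by linarith)

theorem exists_subseq_ae_tendsto {α : Type*} [MeasurableSpace α] {μ : Measure α}
    {E : Type*} [NormedAddCommGroup E] {p : ℝ} (hp : 1 < p) {a : ℕ → α → E} {b : α → E}
    (ha : ∀ k, MemLp (a k) (ENNReal.ofReal p) μ) (hb : MemLp b (ENNReal.ofReal p) μ)
    (h : Tendsto (fun k => ∫ x, ‖a k x - b x‖ ^ p ∂μ) atTop (𝓝 0)) :
    ∃ n : ℕ → ℕ, StrictMono n ∧ ∀ᵐ x ∂μ, Tendsto (fun j => a (n j) x) atTop (𝓝 (b x)) := by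
  obtain ⟨n, hn, hx⟩ := exists_subseq_forall_ae_tendsto_zero_real (μ := μ)
    (g := fun _ k x => ‖a k x - b x‖ ^ p) (fun _ k => ((ha k).sub hb).integrable_rpow hp)
    (fun _ k x => by positivity) fun _ => h
  refine ⟨n, hn, ?_⟩
  filter_upwards [hx] with x hx
  exact tendsto_of_norm_sub_rpow hp (hx 0)

theorem tendsto_integral_inner_of_sub {α : Type*} [MeasurableSpace α] {μ : Measure α}
    {E : Type*} [NormedAddCommGroup E] [InnerProductSpace ℝ E] {p q : ℝ}
    (hpq : p.HolderConjugate q) {g : α → E} (hg : MemLp g (ENNReal.ofReal q) μ)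
    {a : ℕ → α → E} {b : α → E}
    (ha : ∀ k, MemLp (a k) (ENNReal.ofReal p) μ) (hb : MemLp b (ENNReal.ofReal p) μ)
    (h : Tendsto (fun k => ∫ x, ‖a k x - b x‖ ^ p ∂μ) atTop (𝓝 0)) :
    Tendsto (fun k => ∫ x, ⟪g x, a k x⟫ ∂μ) atTop (𝓝 (∫ x, ⟪g x, b x⟫ ∂μ)) := by
  have hp := hpq.lt
  rw [tendsto_iff_norm_sub_tendsto_zero]
  have h1 := (h.rpow_const (p := 1 / p) (Or.inr (by positivity))).const_mul
    ((∫ x, ‖g x‖ ^ q ∂μ) ^ (1 / q))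
  rw [Real.zero_rpow (by positivity), mul_zero] at h1
  refine squeeze_zero (fun _ => norm_nonneg _) (fun k => ?_) h1
  rw [← integral_sub (integrable_inner_of_memLp hpq hg (ha k)) (integrable_inner_of_memLp hpq hg hb)]
  simp_rw [← inner_sub_right]
  exact abs_integral_inner_le hpq hg ((ha k).sub hb)

section Sobolev

variable {N : ℕ} {Ω : Set (Euc N)} {p q : ℝ}

namespace IsSobolevZero

theorem of_isTestFun (hp : 1 < p) {ζ : Euc N → ℝ} (h : IsTestFun Ω ζ) :
    IsSobolevZero p Ω ζ (gradient ζ) :=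
  ⟨h.memLp _, h.memLp_gradient _, fun _ => ζ, fun _ => h,
    by simp [Real.zero_rpow (by linarith : p ≠ 0)],
    by simp [Real.zero_rpow (by linarith : p ≠ 0)]⟩

theorem lin (hp : 1 < p) {u u' : Euc N → ℝ} {v v' : Euc N → Euc N} (h : IsSobolevZero p Ω u v)
    (h' : IsSobolevZero p Ω u' v') (a b : ℝ) :
    IsSobolevZero p Ω (fun x => a * u x + b * u' x) (fun x => a • v x + b • v' x) := by
  obtain ⟨hu, hv, φ, hφ, hφu, hφv⟩ := h
  obtain ⟨hu', hv', φ', hφ', hφu', hφv'⟩ := h'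
  have key : ∀ {E : Type} [NormedAddCommGroup E] [InnerProductSpace ℝ E]
      {A A' : ℕ → Euc N → E} {B B' : Euc N → E},
      (∀ k, MemLp (A k) (ENNReal.ofReal p) (volume.restrict Ω)) →
      (∀ k, MemLp (A' k) (ENNReal.ofReal p) (volume.restrict Ω)) →
      MemLp B (ENNReal.ofReal p) (volume.restrict Ω) →
      MemLp B' (ENNReal.ofReal p) (volume.restrict Ω) →
      Tendsto (fun j => ∫ x in Ω, ‖A j x - B x‖ ^ p) atTop (𝓝 0) →
      Tendsto (fun j => ∫ x in Ω, ‖A' j x - B' x‖ ^ p) atTop (𝓝 0) →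
      Tendsto (fun j => ∫ x in Ω, ‖(a • A j x + b • A' j x) - (a • B x + b • B' x)‖ ^ p) atTop
        (𝓝 0) := by
    intro E _ _ A A' B B' hA hA' hB hB' h1 h2
    have h3 := ((h1.const_mul (|a| ^ p)).add (h2.const_mul (|b| ^ p))).const_mul (2 ^ p)
    simp only [mul_zero, add_zero] at h3
    refine squeeze_zero (fun j => integral_nonneg fun x => by positivity) (fun j => ?_) h3
    have i1 := ((hA j).sub hB).integrable_rpow hp
    have i2 := ((hA' j).sub hB').integrable_rpow hp
    simp only [Pi.sub_apply] at i1 i2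
    rw [← integral_const_mul, ← integral_const_mul,
      ← integral_add (i1.const_mul _) (i2.const_mul _), ← integral_const_mul]
    refine integral_mono_of_nonneg (Eventually.of_forall fun x => by positivity)
      (((i1.const_mul _).add (i2.const_mul _)).const_mul _) (Eventually.of_forall fun x => ?_)
    have h4 := norm_add_rpow_le hp (a • (A j x - B x)) (b • (A' j x - B' x))
    have e : a • (A j x - B x) + b • (A' j x - B' x) =
        (a • A j x + b • A' j x) - (a • B x + b • B' x) := by
      simp only [smul_sub]
      abel
    rw [e, norm_smul, norm_smul, Real.mul_rpow (norm_nonneg _) (norm_nonneg _),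
      Real.mul_rpow (norm_nonneg _) (norm_nonneg _)] at h4
    exact h4
  refine ⟨(hu.const_mul a).add (hu'.const_mul b), (hv.const_smul a).add (hv'.const_smul b),
    fun j x => a * φ j x + b * φ' j x, fun j => (hφ j).lin (hφ' j) a b, ?_, ?_⟩
  · exact key (fun k => (hφ k).memLp _) (fun k => (hφ' k).memLp _) hu hu' hφu hφu'
  · simp only [(hφ _).gradient_lin (hφ' _)]
    exact key (fun k => (hφ k).memLp_gradient _) (fun k => (hφ' k).memLp_gradient _) hv hv' hφv hφv'

theorem sub (hp : 1 < p) {u u' : Euc N → ℝ} {v v' : Euc N → Euc N} (h : IsSobolevZero p Ω u v)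
    (h' : IsSobolevZero p Ω u' v') :
    IsSobolevZero p Ω (fun x => u x - u' x) (fun x => v x - v' x) := by
  simpa [sub_eq_add_neg] using h.lin hp h' 1 (-1)

theorem hasWeakGradOn (hpq : p.HolderConjugate q) {u : Euc N → ℝ} {v : Euc N → Euc N}
    (h : IsSobolevZero p Ω u v) : HasWeakGradOn Ω u v := by
  obtain ⟨hu, hv, φ, hφ, hφu, hφv⟩ := h
  intro ζ hζ i
  have h1 : MemLp (fun x => fderiv ℝ ζ x (EuclideanSpace.single i 1)) (ENNReal.ofReal q)
      (volume.restrict Ω) :=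
    ((hζ.1.continuous_fderiv (by simp)).clm_apply continuous_const).memLp_of_hasCompactSupport
      (hζ.2.1.fderiv_apply ℝ _)
  have h2 : MemLp (fun x => ζ x • EuclideanSpace.single i (1 : ℝ)) (ENNReal.ofReal q)
      (volume.restrict Ω) :=
    (hζ.continuous.smul continuous_const).memLp_of_hasCompactSupport hζ.2.1.smul_right
  have t1 := tendsto_integral_inner_of_sub hpq h1 (fun k => (hφ k).memLp _) hu hφu
  have t2 := (tendsto_integral_inner_of_sub hpq h2 (fun k => (hφ k).memLp_gradient _) hv hφv).neg
  have e1 : ∀ w : Euc N, ∀ x, ⟪ζ x • EuclideanSpace.single i (1 : ℝ), w⟫ = w i * ζ x :=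
    fun w x => by
      rw [real_inner_smul_left, EuclideanSpace.inner_single_left]
      simp [mul_comm]
  have e2 : ∀ k, ∫ x in Ω, ⟪fderiv ℝ ζ x (EuclideanSpace.single i 1), φ k x⟫ =
      - ∫ x in Ω, ⟪ζ x • EuclideanSpace.single i (1 : ℝ), gradient (φ k) x⟫ := fun k => by
    have h3 := hζ.integral_mul_fderiv (hφ k) (EuclideanSpace.single i 1)
    refine Eq.trans ?_ (h3.trans ?_)
    · rfl
    · congr 2
      ext x
      rw [e1, EuclideanSpace.inner_single_right]
      simp
  simp only [e2] at t1
  have h4 := tendsto_nhds_unique t1 t2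
  simp only [e1] at h4
  exact h4

end IsSobolevZero

/-- The measure `ν` is dominated by the Dirichlet form on test functions. -/
structure IsHardyWeight (p : ℝ) (Ω : Set (Euc N)) (ν : Measure (Euc N)) : Prop where
  ac : ν ≪ volume.restrict Ω
  memLp : ∀ ζ, IsTestFun Ω ζ → MemLp ζ (ENNReal.ofReal p) ν
  le : ∀ ζ, IsTestFun Ω ζ → ∫ x, ‖ζ x‖ ^ p ∂ν ≤ ∫ x in Ω, ‖gradient ζ x‖ ^ p

namespace IsHardyWeight

variable {ν : Measure (Euc N)}

theorem memLp_and_le (hp : 1 < p) (hν : IsHardyWeight p Ω ν) {u : Euc N → ℝ} {v : Euc N → Euc N}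
    (h : IsSobolevZero p Ω u v) :
    MemLp u (ENNReal.ofReal p) ν ∧ ∫ x, ‖u x‖ ^ p ∂ν ≤ ∫ x in Ω, ‖v x‖ ^ p := by
  obtain ⟨hu, hv, φ, hφ, hφu, hφv⟩ := h
  obtain ⟨n, hn, hae⟩ := exists_subseq_ae_tendsto hp (fun k => (hφ k).memLp _) hu hφu
  have h0 : 0 ≤ ∫ x in Ω, ‖v x‖ ^ p := integral_nonneg fun x => by positivity
  have hlim : Tendsto (fun j => ENNReal.ofReal ((∫ x in Ω, ‖gradient (φ (n j)) x‖ ^ p) ^ p⁻¹))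
      atTop (𝓝 (ENNReal.ofReal ((∫ x in Ω, ‖v x‖ ^ p) ^ p⁻¹))) :=
    ENNReal.tendsto_ofReal (((tendsto_integral_norm_rpow_of_sub hp
      (fun k => (hφ k).memLp_gradient _) hv hφv).comp hn.tendsto_atTop).rpow_const
        (Or.inr (inv_nonneg.2 (by linarith))))
  have hle : eLpNorm u (ENNReal.ofReal p) ν ≤ ENNReal.ofReal ((∫ x in Ω, ‖v x‖ ^ p) ^ p⁻¹) := by
    refine (Lp.eLpNorm_lim_le_liminf_eLpNorm (f := fun j => φ (n j))
      (fun j => (hν.memLp _ (hφ _)).aestronglyMeasurable) u (hν.ac.ae_le hae)).trans ?_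
    rw [← hlim.liminf_eq]
    refine liminf_le_liminf (Eventually.of_forall fun j => ?_)
    rw [eLpNorm_ofReal_eq hp (hν.memLp _ (hφ _))]
    refine ENNReal.ofReal_le_ofReal (Real.rpow_le_rpow (integral_nonneg fun x => by positivity)
      (hν.le _ (hφ _)) (inv_nonneg.2 (by linarith)))
  have hm : MemLp u (ENNReal.ofReal p) ν :=
    ⟨hu.aestronglyMeasurable.mono_ac hν.ac, hle.trans_lt ENNReal.ofReal_lt_top⟩
  refine ⟨hm, ?_⟩
  rw [eLpNorm_ofReal_eq hp hm, ENNReal.ofReal_le_ofReal_iff (by positivity)] at hle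
  exact (Real.rpow_le_rpow_iff (integral_nonneg fun x => by positivity) h0
    (inv_pos.2 (by linarith))).1 hle

end IsHardyWeight

/-- The energy functional of the perturbed problem. -/
def energy (p ε : ℝ) (Ω : Set (Euc N)) (ν : Measure (Euc N)) (g : Euc N → ℝ)
    (G : Euc N → Euc N) (u : Euc N → ℝ) (v : Euc N → Euc N) : ℝ :=
  (1 / p) * (∫ x in Ω, ‖v x‖ ^ p) - ((1 - ε) / p) * (∫ x, ‖u x‖ ^ p ∂ν)
    + (ε / p) * (∫ x in Ω, ‖u x‖ ^ p)
    - ((∫ x in Ω, ⟪g x, u x⟫) + ∫ x in Ω, ⟪G x, v x⟫)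

section Energy

variable {ε : ℝ} {ν : Measure (Euc N)} {g : Euc N → ℝ} {G : Euc N → Euc N}

theorem energy_le_of_forall_isTestFun (hpq : p.HolderConjugate q) (hν : IsHardyWeight p Ω ν)
    (hg : MemLp g (ENNReal.ofReal q) (volume.restrict Ω))
    (hG : MemLp G (ENNReal.ofReal q) (volume.restrict Ω)) {c : ℝ}
    (hc : ∀ ζ, IsTestFun Ω ζ → c ≤ energy p ε Ω ν g G ζ (gradient ζ))
    {u : Euc N → ℝ} {v : Euc N → Euc N} (h : IsSobolevZero p Ω u v) :
    c ≤ energy p ε Ω ν g G u v := by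
  have hp := hpq.lt
  have hW := h
  obtain ⟨hu, hv, φ, hφ, hφu, hφv⟩ := h
  have hφν : Tendsto (fun j => ∫ x, ‖φ j x - u x‖ ^ p ∂ν) atTop (𝓝 0) :=
    squeeze_zero (fun j => integral_nonneg fun x => by positivity)
      (fun j => (hν.memLp_and_le hp ((IsSobolevZero.of_isTestFun hp (hφ j)).sub hp hW)).2) hφv
  refine ge_of_tendsto' (f := fun j => energy p ε Ω ν g G (φ j) (gradient (φ j))) (x := atTop) ?_
    fun j => hc _ (hφ j)
  refine Tendsto.sub (Tendsto.add (Tendsto.sub (Tendsto.const_mul _ ?_) (Tendsto.const_mul _ ?_))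
    (Tendsto.const_mul _ ?_)) (Tendsto.add ?_ ?_)
  · exact tendsto_integral_norm_rpow_of_sub hp (fun k => (hφ k).memLp_gradient _) hv hφv
  · exact tendsto_integral_norm_rpow_of_sub hp (fun k => hν.memLp _ (hφ k))
      (hν.memLp_and_le hp hW).1 hφν
  · exact tendsto_integral_norm_rpow_of_sub hp (fun k => (hφ k).memLp _) hu hφu
  · exact tendsto_integral_inner_of_sub hpq hg (fun k => (hφ k).memLp _) hu hφu
  · exact tendsto_integral_inner_of_sub hpq hG (fun k => (hφ k).memLp_gradient _) hv hφv

/-- The Euler–Lagrange equation for a minimizer of the energy. -/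
theorem euler_lagrange (hpq : p.HolderConjugate q) (hν : IsHardyWeight p Ω ν)
    (hg : MemLp g (ENNReal.ofReal q) (volume.restrict Ω))
    (hG : MemLp G (ENNReal.ofReal q) (volume.restrict Ω))
    {u : Euc N → ℝ} {v : Euc N → Euc N} (hW : IsSobolevZero p Ω u v)
    (hmin : ∀ ζ, IsTestFun Ω ζ → energy p ε Ω ν g G u v ≤ energy p ε Ω ν g G ζ (gradient ζ))
    {h : Euc N → ℝ} {k : Euc N → Euc N} (hk : IsSobolevZero p Ω h k) :
    (∫ x in Ω, ⟪‖v x‖ ^ (p - 2) • v x, k x⟫) - (1 - ε) * (∫ x, ⟪‖u x‖ ^ (p - 2) • u x, h x⟫ ∂ν)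
      + ε * (∫ x in Ω, ⟪‖u x‖ ^ (p - 2) • u x, h x⟫) =
      (∫ x in Ω, ⟪g x, h x⟫) + ∫ x in Ω, ⟪G x, k x⟫ := by
  have hp := hpq.lt
  have hp0 : p ≠ 0 := by linarith
  have hline : ∀ t : ℝ, IsSobolevZero p Ω (fun x => u x + t • h x) (fun x => v x + t • k x) :=
    fun t => by simpa using hW.lin hp hk 1 t
  have hlin : ∀ {E : Type} [NormedAddCommGroup E] [InnerProductSpace ℝ E] {A B C : Euc N → E},
      MemLp A (ENNReal.ofReal q) (volume.restrict Ω) →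
      MemLp B (ENNReal.ofReal p) (volume.restrict Ω) →
      MemLp C (ENNReal.ofReal p) (volume.restrict Ω) →
      HasDerivAt (fun t : ℝ => ∫ x in Ω, ⟪A x, B x + t • C x⟫) (∫ x in Ω, ⟪A x, C x⟫) 0 := by
    intro E _ _ A B C hA hB hC
    have e : (fun t : ℝ => ∫ x in Ω, ⟪A x, B x + t • C x⟫) =
        fun t : ℝ => (∫ x in Ω, ⟪A x, B x⟫) + t * ∫ x in Ω, ⟪A x, C x⟫ := by
      funext t
      simp_rw [inner_add_right, real_inner_smul_right]
      rw [integral_add (integrable_inner_of_memLp hpq hA hB)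
        ((integrable_inner_of_memLp hpq hA hC).const_mul _), integral_const_mul]
    rw [e]
    simpa using ((hasDerivAt_id (0 : ℝ)).mul_const (∫ x in Ω, ⟪A x, C x⟫)).const_add
      (∫ x in Ω, ⟪A x, B x⟫)
  have hd : HasDerivAt (fun t : ℝ => energy p ε Ω ν g G (fun x => u x + t • h x)
      (fun x => v x + t • k x)) _ 0 :=
    ((((hasDerivAt_integral_norm_rpow hp hW.2.1 hk.2.1).const_mul (1 / p)).sub
      ((hasDerivAt_integral_norm_rpow hp (hν.memLp_and_le hp hW).1
        (hν.memLp_and_le hp hk).1).const_mul ((1 - ε) / p))).add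
      ((hasDerivAt_integral_norm_rpow hp hW.1 hk.1).const_mul (ε / p))).sub
      ((hlin hg hW.1 hk.1).add (hlin hG hW.2.1 hk.2.1))
  have hloc : IsLocalMin (fun t : ℝ => energy p ε Ω ν g G (fun x => u x + t • h x)
      (fun x => v x + t • k x)) 0 := Eventually.of_forall fun t => by
    simpa using energy_le_of_forall_isTestFun hpq hν hg hG hmin (hline t)
  have h0 := hloc.hasDerivAt_eq_zero hd
  have h1 : ∀ a b c : ℝ, 1 / p * (p * a) - (1 - ε) / p * (p * b) + ε / p * (p * c) =
      a - (1 - ε) * b + ε * c := fun a b c => by field_simp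
  rw [h1] at h0
  linarith

end Energy

end Sobolev

theorem tendsto_integral_norm_smul_rpow_zero {α : Type*} [MeasurableSpace α] {μ : Measure α}
    {E : Type*} [NormedAddCommGroup E] [NormedSpace ℝ E] {p : ℝ} (hp : 1 < p)
    {b : α → E} (hb : MemLp b (ENNReal.ofReal p) μ) {s : ℕ → α → ℝ} {B : ℝ}
    (hsm : ∀ k, AEStronglyMeasurable (s k) μ) (hsB : ∀ k x, |s k x| ≤ B)
    (hs : ∀ᵐ x ∂μ, Tendsto (fun k => s k x) atTop (𝓝 0)) :
    Tendsto (fun k => ∫ x, ‖s k x • b x‖ ^ p ∂μ) atTop (𝓝 0) := by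
  have hp0 : 0 < p := by linarith
  have h := tendsto_integral_of_dominated_convergence (μ := μ)
    (F := fun k x => ‖s k x • b x‖ ^ p) (f := fun _ => (0 : ℝ)) (fun x => B ^ p * ‖b x‖ ^ p)
    (fun k => (((hsm k).smul hb.aestronglyMeasurable).norm.aemeasurable.pow_const
      _).aestronglyMeasurable)
    ((hb.integrable_rpow hp).const_mul _)
    (fun k => Eventually.of_forall fun x => by
      have hB : 0 ≤ B := (abs_nonneg _).trans (hsB k x)
      rw [Real.norm_of_nonneg (by positivity), norm_smul,
        Real.mul_rpow (norm_nonneg _) (norm_nonneg _)]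
      gcongr
      exact hsB k x)
    (by
      filter_upwards [hs] with x hx
      have h1 := (hx.smul_const (b x)).norm.rpow_const (p := p) (Or.inr hp0.le)
      simpa [Real.zero_rpow hp0.ne'] using h1)
  simpa using h

theorem exists_forall_integral_norm_rpow_le {α : Type*} [MeasurableSpace α] {μ : Measure α}
    {E : Type*} [NormedAddCommGroup E] [InnerProductSpace ℝ E] [FiniteDimensional ℝ E] {p : ℝ}
    (hp : 1 < p) {a : ℕ → α → E} {b : α → E} (ha : ∀ k, MemLp (a k) (ENNReal.ofReal p) μ)
    (hb : MemLp b (ENNReal.ofReal p) μ)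
    (h : Tendsto (fun k => ∫ x, ‖a k x - b x‖ ^ p ∂μ) atTop (𝓝 0)) :
    ∃ M, ∀ k, ∫ x, ‖a k x‖ ^ p ∂μ ≤ M := by
  obtain ⟨M, hM⟩ := (tendsto_integral_norm_rpow_of_sub hp ha hb h).bddAbove_range
  exact ⟨M, fun k => hM (Set.mem_range_self k)⟩

section Sobolev

variable {N : ℕ} {Ω : Set (Euc N)} {p q ε : ℝ} {ν : Measure (Euc N)} {g : Euc N → ℝ}
  {G : Euc N → Euc N}

/-- Perturbing a minimizing sequence by truncations of a weakly null, almost everywhere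
convergent sequence does not decrease the Dirichlet integral asymptotically. -/
theorem exists_integral_gradient_rpow_le (hpq : p.HolderConjugate q) (hν : IsHardyWeight p Ω ν)
    (hg : MemLp g (ENNReal.ofReal q) (volume.restrict Ω))
    (hG : MemLp G (ENNReal.ofReal q) (volume.restrict Ω))
    {u z : ℕ → Euc N → ℝ} (hu : ∀ k, IsTestFun Ω (u k)) (hz : ∀ k, IsTestFun Ω (z k))
    {M M' : ℝ} (hM0 : ∀ k, ∫ x in Ω, ‖u k x‖ ^ p ≤ M)
    (hM1 : ∀ k, ∫ x in Ω, ‖gradient (u k) x‖ ^ p ≤ M)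
    (hMz : ∀ k, ∫ x in Ω, ‖gradient (z k) x‖ ^ p ≤ M')
    (hweak : ∀ H : Euc N → Euc N, MemLp H (ENNReal.ofReal q) (volume.restrict Ω) →
      Tendsto (fun k => ∫ x in Ω, ⟪H x, gradient (z k) x⟫) atTop (𝓝 0))
    (hz0 : ∀ᵐ x ∂volume.restrict Ω, Tendsto (fun k => z k x) atTop (𝓝 0))
    {c : ℝ} (hc : ∀ ζ, IsTestFun Ω ζ → c ≤ energy p ε Ω ν g G ζ (gradient ζ))
    (hlim : Tendsto (fun k => energy p ε Ω ν g G (u k) (gradient (u k))) atTop (𝓝 c))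
    {ψ : Euc N → ℝ} (hψ : IsTestFun Ω ψ) (hψ0 : ∀ x, 0 ≤ ψ x) (hψ1 : ∀ x, ψ x ≤ 1) :
    ∃ r : ℕ → ℝ, Tendsto r atTop (𝓝 0) ∧ ∀ k, ∫ x in Ω, ‖gradient (u k) x‖ ^ p ≤
      (∫ x in Ω, ‖gradient (u k) x - ((ψ x / (1 + z k x ^ 2)) • gradient (z k) x
        + Real.arctan (z k x) • gradient ψ x)‖ ^ p) + r k := by
  have hp := hpq.lt
  have hp0 : 0 < p := by linarith
  set T : ℕ → Euc N → ℝ := fun k x => ψ x * Real.arctan (z k x) with hT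
  have hTt : ∀ k, IsTestFun Ω (T k) := fun k =>
    hψ.mul (Real.contDiff_arctan.comp (hz k).1)
  have hgT : ∀ k x, gradient (T k) x = (ψ x / (1 + z k x ^ 2)) • gradient (z k) x
      + Real.arctan (z k x) • gradient ψ x := fun k x => hψ.gradient_mul_arctan (hz k) x
  have hatm : ∀ k, Continuous fun x => Real.arctan (z k x) := fun k =>
    Real.continuous_arctan.comp (hz k).continuous
  have hatB : ∀ k x, |Real.arctan (z k x)| ≤ π / 2 := fun k x => by
    rw [abs_le]
    exact ⟨(Real.neg_pi_div_two_lt_arctan _).le, (Real.arctan_lt_pi_div_two _).le⟩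
  have hat0 : ∀ᵐ x ∂volume.restrict Ω, Tendsto (fun k => Real.arctan (z k x)) atTop (𝓝 0) := by
    filter_upwards [hz0] with x hx
    have h1 := (Real.continuous_arctan.tendsto 0).comp hx
    rw [Real.arctan_zero] at h1
    exact h1
  have hTμ : Tendsto (fun k => ∫ x in Ω, ‖T k x‖ ^ p) atTop (𝓝 0) := by
    simpa only [hT, smul_eq_mul, mul_comm] using tendsto_integral_norm_smul_rpow_zero hp
      (hψ.memLp _) (fun k => (hatm k).aestronglyMeasurable) hatB hat0
  have hTν : Tendsto (fun k => ∫ x, ‖T k x‖ ^ p ∂ν) atTop (𝓝 0) := by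
    simpa only [hT, smul_eq_mul, mul_comm] using tendsto_integral_norm_smul_rpow_zero hp
      (hν.memLp _ hψ) (fun k => (hatm k).aestronglyMeasurable) hatB (hν.ac.ae_le hat0)
  have hD1 := tendsto_integral_norm_add_rpow_sub hp (fun k => (hu k).memLp _)
    (fun k => ((hTt k).memLp _).neg) hM0 (by simpa using hTμ)
  have hD2 := tendsto_integral_norm_add_rpow_sub hp (fun k => hν.memLp _ (hu k))
    (fun k => (hν.memLp _ (hTt k)).neg) (fun k => (hν.le _ (hu k)).trans (hM1 k))
    (by simpa using hTν)
  have hL1 : Tendsto (fun k => ∫ x in Ω, ⟪g x, T k x⟫) atTop (𝓝 0) := by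
    simpa using tendsto_integral_inner_of_sub hpq hg (fun k => (hTt k).memLp _)
      (MemLp.zero' (ε := ℝ)) (by simpa using hTμ)
  have hθm : ∀ k, Continuous fun x => ψ x / (1 + z k x ^ 2) := fun k =>
    hψ.continuous.div (by have := (hz k).continuous; fun_prop) fun x => by positivity
  have hθ1 : ∀ k x, |ψ x / (1 + z k x ^ 2)| ≤ 1 := fun k x => by
    rw [abs_of_nonneg (div_nonneg (hψ0 x) (by positivity)), div_le_one (by positivity)]
    nlinarith [hψ1 x, sq_nonneg (z k x)]
  have hθ : ∀ᵐ x ∂volume.restrict Ω,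
      Tendsto (fun k => ψ x / (1 + z k x ^ 2)) atTop (𝓝 (ψ x)) := by
    filter_upwards [hz0] with x hx
    have h1 : Tendsto (fun k => ψ x / (1 + z k x ^ 2)) atTop (𝓝 (ψ x / (1 + 0 ^ 2))) :=
      tendsto_const_nhds.div ((hx.pow 2).const_add 1) (by norm_num)
    rw [show ψ x / (1 + 0 ^ 2) = ψ x by simp] at h1
    exact h1
  have hL2 : Tendsto (fun k => ∫ x in Ω, ⟪G x, gradient (T k) x⟫) atTop (𝓝 0) := by
    have h1 := tendsto_integral_mul_inner_of_weak hpq hG (fun k => (hz k).memLp_gradient _) hMz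
      hweak (fun k => (hθm k).aestronglyMeasurable) hψ.continuous.aestronglyMeasurable hθ1
      (fun x => by rw [abs_of_nonneg (hψ0 x)]; exact hψ1 x) hθ
    have ham : ∀ k, MemLp (fun x => Real.arctan (z k x) • gradient ψ x) (ENNReal.ofReal p)
        (volume.restrict Ω) := fun k =>
      ((hatm k).smul hψ.continuous_gradient).memLp_of_hasCompactSupport
        hψ.hasCompactSupport_gradient.smul_left
    have h2 : Tendsto (fun k => ∫ x in Ω, ⟪G x, Real.arctan (z k x) • gradient ψ x⟫) atTop
        (𝓝 0) := by
      have h3 := tendsto_integral_norm_smul_rpow_zero hp (hψ.memLp_gradient _)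
        (fun k => (hatm k).aestronglyMeasurable) hatB hat0
      simpa using tendsto_integral_inner_of_sub hpq hG ham
        (MemLp.zero' (ε := Euc N)) (by simpa using h3)
    have h4 := h1.add h2
    rw [add_zero] at h4
    refine h4.congr fun k => ?_
    have e1 : ∀ x, ⟪G x, gradient (T k) x⟫ = ψ x / (1 + z k x ^ 2) * ⟪G x, gradient (z k) x⟫ +
        ⟪G x, Real.arctan (z k x) • gradient ψ x⟫ := fun x => by
      rw [hgT, inner_add_right, real_inner_smul_right]
    simp_rw [e1]
    have i2 := integrable_inner_of_memLp hpq hG (ham k)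
    have i1 : Integrable (fun x => ψ x / (1 + z k x ^ 2) * ⟪G x, gradient (z k) x⟫)
        (volume.restrict Ω) := by
      refine ((integrable_inner_of_memLp hpq hG ((hTt k).memLp_gradient _)).sub i2).congr
        (Eventually.of_forall fun x => ?_)
      simp only [Pi.sub_apply, e1, add_sub_cancel_right]
    exact (integral_add i1 i2).symm
  refine ⟨fun k => p * (energy p ε Ω ν g G (u k) (gradient (u k)) - c)
    - (1 - ε) * ((∫ x, ‖u k x + (-T k) x‖ ^ p ∂ν) - ∫ x, ‖u k x‖ ^ p ∂ν)
    + ε * ((∫ x in Ω, ‖u k x + (-T k) x‖ ^ p) - ∫ x in Ω, ‖u k x‖ ^ p)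
    + p * ((∫ x in Ω, ⟪g x, T k x⟫) + ∫ x in Ω, ⟪G x, gradient (T k) x⟫), ?_, fun k => ?_⟩
  · have h1 := ((((hlim.sub_const c).const_mul p).sub (hD2.const_mul (1 - ε))).add
      (hD1.const_mul ε)).add ((hL1.add hL2).const_mul p)
    simpa using h1
  · have h1 := hc _ ((hu k).sub (hTt k))
    have e1 : ∫ x in Ω, ⟪g x, u k x - T k x⟫ =
        (∫ x in Ω, ⟪g x, u k x⟫) - ∫ x in Ω, ⟪g x, T k x⟫ := by
      simp_rw [inner_sub_right]
      exact integral_sub (integrable_inner_of_memLp hpq hg ((hu k).memLp _))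
        (integrable_inner_of_memLp hpq hg ((hTt k).memLp _))
    have e2 : ∫ x in Ω, ⟪G x, gradient (u k) x - gradient (T k) x⟫ =
        (∫ x in Ω, ⟪G x, gradient (u k) x⟫) - ∫ x in Ω, ⟪G x, gradient (T k) x⟫ := by
      simp_rw [inner_sub_right]
      exact integral_sub (integrable_inner_of_memLp hpq hG ((hu k).memLp_gradient _))
        (integrable_inner_of_memLp hpq hG ((hTt k).memLp_gradient _))
    simp only [energy, (hu k).gradient_sub (hTt k), e1, e2] at h1 ⊢
    simp only [← hgT, Pi.neg_apply, ← sub_eq_add_neg]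
    have h2 := mul_le_mul_of_nonneg_left h1 hp0.le
    field_simp at h2 ⊢
    linarith

/-- Localized strong convergence of the gradients of a minimizing sequence. -/
theorem tendsto_localized_gradient (hpq : p.HolderConjugate q) (hν : IsHardyWeight p Ω ν)
    (hg : MemLp g (ENNReal.ofReal q) (volume.restrict Ω))
    (hG : MemLp G (ENNReal.ofReal q) (volume.restrict Ω))
    {u φ : ℕ → Euc N → ℝ} (hu : ∀ k, IsTestFun Ω (u k)) (hφ : ∀ k, IsTestFun Ω (φ k))
    {v : Euc N → Euc N} (hv : MemLp v (ENNReal.ofReal p) (volume.restrict Ω))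
    {M : ℝ} (hM0 : ∀ k, ∫ x in Ω, ‖u k x‖ ^ p ≤ M)
    (hM1 : ∀ k, ∫ x in Ω, ‖gradient (u k) x‖ ^ p ≤ M)
    (hφv : Tendsto (fun k => ∫ x in Ω, ‖gradient (φ k) x - v x‖ ^ p) atTop (𝓝 0))
    (hweak : ∀ H : Euc N → Euc N, MemLp H (ENNReal.ofReal q) (volume.restrict Ω) →
      Tendsto (fun k => ∫ x in Ω, ⟪H x, gradient (u k) x⟫) atTop (𝓝 (∫ x in Ω, ⟪H x, v x⟫)))
    (hz0 : ∀ᵐ x ∂volume.restrict Ω, Tendsto (fun k => u k x - φ k x) atTop (𝓝 0))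
    {c : ℝ} (hc : ∀ ζ, IsTestFun Ω ζ → c ≤ energy p ε Ω ν g G ζ (gradient ζ))
    (hlim : Tendsto (fun k => energy p ε Ω ν g G (u k) (gradient (u k))) atTop (𝓝 c))
    {ψ : Euc N → ℝ} (hψ : IsTestFun Ω ψ) (hψ0 : ∀ x, 0 ≤ ψ x) (hψ1 : ∀ x, ψ x ≤ 1) :
    Tendsto (fun k => ∫ x in Ω,
      ψ x / (1 + (u k x - φ k x) ^ 2) * ‖gradient (u k) x - v x‖ ^ p) atTop (𝓝 0) := by
  have hp := hpq.lt
  have hp0 : 0 < p := by linarith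
  set z : ℕ → Euc N → ℝ := fun k x => u k x - φ k x with hzdef
  have hz : ∀ k, IsTestFun Ω (z k) := fun k => (hu k).sub (hφ k)
  have hgz : ∀ k x, gradient (z k) x = gradient (u k) x - gradient (φ k) x := fun k x =>
    (hu k).gradient_sub (hφ k) x
  obtain ⟨Mφ, hMφ⟩ := exists_forall_integral_norm_rpow_le hp (fun k => (hφ k).memLp_gradient _)
    hv hφv
  have hMz : ∀ k, ∫ x in Ω, ‖gradient (z k) x‖ ^ p ≤ 2 ^ p * (M + Mφ) := fun k => by
    simp only [hgz]
    refine (integral_norm_sub_rpow_le hp ((hu k).memLp_gradient _)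
      ((hφ k).memLp_gradient _)).trans ?_
    gcongr
    exacts [hM1 k, hMφ k]
  have hzw : ∀ H : Euc N → Euc N, MemLp H (ENNReal.ofReal q) (volume.restrict Ω) →
      Tendsto (fun k => ∫ x in Ω, ⟪H x, gradient (z k) x⟫) atTop (𝓝 0) := fun H hH => by
    have h1 := (hweak H hH).sub
      (tendsto_integral_inner_of_sub hpq hH (fun k => (hφ k).memLp_gradient _) hv hφv)
    rw [sub_self] at h1
    refine h1.congr fun k => ?_
    simp_rw [hgz, inner_sub_right]
    exact (integral_sub (integrable_inner_of_memLp hpq hH ((hu k).memLp_gradient _))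
      (integrable_inner_of_memLp hpq hH ((hφ k).memLp_gradient _))).symm
  obtain ⟨r, hr, hle⟩ := exists_integral_gradient_rpow_le hpq hν hg hG hu hz hM0 hM1 hMz hzw hz0
    hc hlim hψ hψ0 hψ1
  set θ : ℕ → Euc N → ℝ := fun k x => ψ x / (1 + z k x ^ 2) with hθdef
  have hθc : ∀ k, Continuous (θ k) := fun k =>
    hψ.continuous.div (by have := (hz k).continuous; fun_prop) fun x => by positivity
  have hθm : ∀ k, AEStronglyMeasurable (θ k) (volume.restrict Ω) := fun k =>
    (hθc k).aestronglyMeasurable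
  have hθ0 : ∀ k x, 0 ≤ θ k x := fun k x => div_nonneg (hψ0 x) (by positivity)
  have hθ1 : ∀ k x, θ k x ≤ 1 := fun k x => by
    simp only [hθdef]
    rw [div_le_one (by positivity)]
    nlinarith [hψ1 x, sq_nonneg (z k x)]
  have hθa : ∀ k x, |θ k x| ≤ 1 := fun k x => by rw [abs_of_nonneg (hθ0 k x)]; exact hθ1 k x
  have hθψ : ∀ᵐ x ∂volume.restrict Ω, Tendsto (fun k => θ k x) atTop (𝓝 (ψ x)) := by
    filter_upwards [hz0] with x hx
    have h1 : Tendsto (fun k => ψ x / (1 + z k x ^ 2)) atTop (𝓝 (ψ x / (1 + 0 ^ 2))) :=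
      tendsto_const_nhds.div ((hx.pow 2).const_add 1) (by norm_num)
    rw [show ψ x / (1 + 0 ^ 2) = ψ x by simp] at h1
    exact h1
  have hmulθ : ∀ k {F : Euc N → ℝ}, Integrable F (volume.restrict Ω) →
      Integrable (fun x => θ k x * F x) (volume.restrict Ω) := fun k F hF =>
    hF.bdd_mul (hθm k) (Eventually.of_forall fun x => hθa k x)
  have hsmulθ : ∀ k {F : Euc N → Euc N}, MemLp F (ENNReal.ofReal p) (volume.restrict Ω) →
      MemLp (fun x => θ k x • F x) (ENNReal.ofReal p) (volume.restrict Ω) := fun k F hF =>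
    hF.mono ((hθm k).smul hF.aestronglyMeasurable) (Eventually.of_forall fun x => by
      rw [norm_smul]
      exact mul_le_of_le_one_left (norm_nonneg _) (hθa k x))
  have hUi : ∀ k, Integrable (fun x => ‖gradient (u k) x‖ ^ p) (volume.restrict Ω) := fun k =>
    ((hu k).memLp_gradient _).integrable_rpow hp
  have hVi : Integrable (fun x => ‖v x‖ ^ p) (volume.restrict Ω) := hv.integrable_rpow hp
  have hUVi : ∀ k, Integrable (fun x => ‖gradient (u k) x‖ ^ p - ‖v x‖ ^ p)
      (volume.restrict Ω) := fun k => (hUi k).sub hVi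
  -- the truncated competitors are asymptotically convex combinations of `∇u k` and `v`
  have hatB : ∀ k x, |Real.arctan (z k x)| ≤ π / 2 := fun k x => by
    rw [abs_le]
    exact ⟨(Real.neg_pi_div_two_lt_arctan _).le, (Real.arctan_lt_pi_div_two _).le⟩
  have hatm : ∀ k, Continuous fun x => Real.arctan (z k x) := fun k =>
    Real.continuous_arctan.comp (hz k).continuous
  have hat0 : ∀ᵐ x ∂volume.restrict Ω, Tendsto (fun k => Real.arctan (z k x)) atTop (𝓝 0) := by
    filter_upwards [hz0] with x hx
    have h1 := (Real.continuous_arctan.tendsto 0).comp hx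
    rw [Real.arctan_zero] at h1
    exact h1
  have ham : ∀ k, MemLp (fun x => Real.arctan (z k x) • gradient ψ x) (ENNReal.ofReal p)
      (volume.restrict Ω) := fun k =>
    ((hatm k).smul hψ.continuous_gradient).memLp_of_hasCompactSupport
      hψ.hasCompactSupport_gradient.smul_left
  set b : ℕ → Euc N → Euc N := fun k x => (1 - θ k x) • gradient (u k) x + θ k x • v x with hbdef
  set s : ℕ → Euc N → Euc N := fun k x => θ k x • (gradient (φ k) x - v x)
    - Real.arctan (z k x) • gradient ψ x with hsdef
  have hbm : ∀ k, MemLp (b k) (ENNReal.ofReal p) (volume.restrict Ω) := fun k => by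
    have h1 := (((hu k).memLp_gradient (ENNReal.ofReal p)).sub
      (hsmulθ k ((hu k).memLp_gradient (ENNReal.ofReal p)))).add (hsmulθ k hv)
    refine h1.ae_eq (Eventually.of_forall fun x => ?_)
    simp [hbdef, sub_smul]
  have hφvm : ∀ k, MemLp (fun x => gradient (φ k) x - v x) (ENNReal.ofReal p)
      (volume.restrict Ω) := fun k => ((hφ k).memLp_gradient _).sub hv
  have hsm : ∀ k, MemLp (s k) (ENNReal.ofReal p) (volume.restrict Ω) := fun k =>
    (hsmulθ k (hφvm k)).sub (ham k)
  have hbi : ∀ k, ∫ x in Ω, ‖b k x‖ ^ p ≤ (∫ x in Ω, ‖gradient (u k) x‖ ^ p)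
      - ∫ x in Ω, θ k x * (‖gradient (u k) x‖ ^ p - ‖v x‖ ^ p) := fun k => by
    rw [← integral_sub (hUi k) (hmulθ k (hUVi k))]
    refine integral_mono ((hbm k).integrable_rpow hp)
      ((hUi k).sub (hmulθ k (hUVi k))) fun x => ?_
    have h1 := norm_rpow_convex hp (hθ0 k x) (hθ1 k x) (gradient (u k) x) (v x)
    simp only [hbdef]
    linarith
  have hbM : ∀ k, ∫ x in Ω, ‖b k x‖ ^ p ≤ M + ∫ x in Ω, ‖v x‖ ^ p := fun k => by
    refine (integral_mono ((hbm k).integrable_rpow hp) ((hUi k).add hVi) fun x => ?_).trans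
      ((integral_add (hUi k) hVi).trans_le (by gcongr; exact hM1 k))
    have h1 := norm_rpow_convex hp (hθ0 k x) (hθ1 k x) (gradient (u k) x) (v x)
    have h2 : 0 ≤ ‖gradient (u k) x‖ ^ p := by positivity
    have h3 : 0 ≤ ‖v x‖ ^ p := by positivity
    simp only [hbdef, Pi.add_apply]
    nlinarith [hθ0 k x, hθ1 k x]
  have hs0 : Tendsto (fun k => ∫ x in Ω, ‖s k x‖ ^ p) atTop (𝓝 0) := by
    have h3 := tendsto_integral_norm_smul_rpow_zero hp (hψ.memLp_gradient _)
      (fun k => (hatm k).aestronglyMeasurable) hatB hat0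
    have h4 := (hφv.add h3).const_mul (2 ^ p)
    simp only [add_zero, mul_zero] at h4
    refine squeeze_zero (fun k => integral_nonneg fun x => by positivity) (fun k => ?_) h4
    refine (integral_norm_sub_rpow_le hp (hsmulθ k (hφvm k)) (ham k)).trans ?_
    refine mul_le_mul_of_nonneg_left (add_le_add ?_ le_rfl) (by positivity)
    exact integral_mono ((hsmulθ k (hφvm k)).integrable_rpow hp) ((hφvm k).integrable_rpow hp)
      fun x => Real.rpow_le_rpow (norm_nonneg _) (by
        rw [norm_smul]
        exact mul_le_of_le_one_left (norm_nonneg _) (hθa k x)) hp0.le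
  have hbs := tendsto_integral_norm_add_rpow_sub hp hbm hsm hbM hs0
  have hupper : ∀ k, ∫ x in Ω, θ k x * (‖gradient (u k) x‖ ^ p - ‖v x‖ ^ p) ≤
      r k + ((∫ x in Ω, ‖b k x + s k x‖ ^ p) - ∫ x in Ω, ‖b k x‖ ^ p) := fun k => by
    have h1 := hle k
    have e : ∀ x, gradient (u k) x - ((ψ x / (1 + z k x ^ 2)) • gradient (z k) x
        + Real.arctan (z k x) • gradient ψ x) = b k x + s k x := fun x => by
      simp only [hbdef, hsdef, hgz, hθdef, smul_sub, sub_smul, one_smul]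
      abel
    simp only [e] at h1
    linarith [hbi k]
  -- weak convergence handles the linear part of the convexity defect
  have hH := memLp_rpow_sub_two_smul hp hpq hv
  have huvm : ∀ k, MemLp (fun x => gradient (u k) x - v x) (ENNReal.ofReal p)
      (volume.restrict Ω) := fun k => ((hu k).memLp_gradient _).sub hv
  have hlin := tendsto_integral_mul_inner_of_weak hpq hH huvm
    (M := 2 ^ p * (M + ∫ x in Ω, ‖v x‖ ^ p))
    (fun k => (integral_norm_sub_rpow_le hp ((hu k).memLp_gradient _) hv).trans
      (by gcongr; exact hM1 k))
    (fun H hH' => by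
      have h1 := (hweak H hH').sub_const (∫ x in Ω, ⟪H x, v x⟫)
      rw [sub_self] at h1
      refine h1.congr fun k => ?_
      simp_rw [inner_sub_right]
      exact (integral_sub (integrable_inner_of_memLp hpq hH' ((hu k).memLp_gradient _))
        (integrable_inner_of_memLp hpq hH' hv)).symm)
    hθm hψ.continuous.aestronglyMeasurable hθa
    (fun x => by rw [abs_of_nonneg (hψ0 x)]; exact hψ1 x) hθψ
  refine tendsto_zero_of_le_add (M := ∫ x in Ω, ‖v x‖ ^ p)
    (fun k => integral_nonneg fun x => mul_nonneg (hθ0 k x) (by positivity)) fun η hη => ?_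
  obtain ⟨C, hC, hconv⟩ := exists_norm_sub_rpow_le (E := Euc N) hp hη
  refine ⟨fun k => C * ((r k + ((∫ x in Ω, ‖b k x + s k x‖ ^ p) - ∫ x in Ω, ‖b k x‖ ^ p)) / 2
    - p / 2 * ∫ x in Ω, θ k x * ⟪‖v x‖ ^ (p - 2) • v x, gradient (u k) x - v x⟫), ?_,
    fun k => ?_⟩
  · have h1 := (((hr.add hbs).div_const 2).sub (hlin.const_mul (p / 2))).const_mul C
    simpa using h1
  · have i1 := hmulθ k (hUVi k)
    have i2 := hmulθ k (integrable_inner_of_memLp hpq hH (huvm k))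
    have h1 : ∀ x, θ k x * ‖gradient (u k) x - v x‖ ^ p ≤ η * ‖v x‖ ^ p +
        (C / 2 * (θ k x * (‖gradient (u k) x‖ ^ p - ‖v x‖ ^ p))
        - C * (p / 2) * (θ k x * ⟪‖v x‖ ^ (p - 2) • v x, gradient (u k) x - v x⟫)) := fun x => by
      have h2 := hconv (v x) (gradient (u k) x)
      have h3 := norm_rpow_add_inner_le hp (v x) ((1 / 2 : ℝ) • (v x + gradient (u k) x))
      have e1 : (1 / 2 : ℝ) • (v x + gradient (u k) x) - v x =
          (1 / 2 : ℝ) • (gradient (u k) x - v x) := by module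
      rw [e1, real_inner_smul_right] at h3
      rw [norm_sub_rev] at h2
      rw [real_inner_smul_left]
      have h4 : ‖gradient (u k) x - v x‖ ^ p ≤ η * ‖v x‖ ^ p + C * ((‖gradient (u k) x‖ ^ p
          - ‖v x‖ ^ p) / 2 - p / 2 * (‖v x‖ ^ (p - 2) * ⟪v x, gradient (u k) x - v x⟫)) := by
        refine h2.trans ?_
        refine add_le_add le_rfl (mul_le_mul_of_nonneg_left ?_ hC)
        linarith
      have h5 := mul_le_mul_of_nonneg_left h4 (hθ0 k x)
      have h6 : θ k x * (η * ‖v x‖ ^ p) ≤ η * ‖v x‖ ^ p :=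
        mul_le_of_le_one_left (by positivity) (hθ1 k x)
      refine h5.trans ?_
      rw [mul_add]
      refine add_le_add h6 (le_of_eq ?_)
      ring
    have i12 : Integrable (fun x => C / 2 * (θ k x * (‖gradient (u k) x‖ ^ p - ‖v x‖ ^ p))
        - C * (p / 2) * (θ k x * ⟪‖v x‖ ^ (p - 2) • v x, gradient (u k) x - v x⟫))
        (volume.restrict Ω) := (i1.const_mul _).sub (i2.const_mul _)
    have i3 : Integrable (fun x => η * ‖v x‖ ^ p +
        (C / 2 * (θ k x * (‖gradient (u k) x‖ ^ p - ‖v x‖ ^ p))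
        - C * (p / 2) * (θ k x * ⟪‖v x‖ ^ (p - 2) • v x, gradient (u k) x - v x⟫)))
        (volume.restrict Ω) :=
      (hVi.const_mul _).add i12
    refine (integral_mono (hmulθ k ((huvm k).integrable_rpow hp)) i3 h1).trans ?_
    rw [integral_add (hVi.const_mul _) i12,
      integral_sub (i1.const_mul _) (i2.const_mul _), integral_const_mul, integral_const_mul,
      integral_const_mul]
    have h7 := mul_le_mul_of_nonneg_left (hupper k) (by positivity : 0 ≤ C / 2)
    linarith

end Sobolev

section Minimizers

variable {N : ℕ} {Ω : Set (Euc N)} {p q ε : ℝ} {ν : Measure (Euc N)} {g : Euc N → ℝ}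
  {G : Euc N → Euc N}

/-- A weakly null sequence of test functions bounded in `W^{1,p}` has a subsequence converging
to zero almost everywhere. -/
theorem IsTestFun.exists_subseq_ae_tendsto_zero (hpq : p.HolderConjugate q)
    {z : ℕ → Euc N → ℝ} (hz : ∀ k, IsTestFun Ω (z k)) {M : ℝ}
    (hM0 : ∀ k, ∫ x in Ω, ‖z k x‖ ^ p ≤ M) (hM1 : ∀ k, ∫ x in Ω, ‖gradient (z k) x‖ ^ p ≤ M)
    (hw : ∀ h : Euc N → ℝ, MemLp h (ENNReal.ofReal q) (volume.restrict Ω) →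
      Tendsto (fun k => ∫ x in Ω, ⟪h x, z k x⟫) atTop (𝓝 0)) :
    ∃ n : ℕ → ℕ, StrictMono n ∧
      ∀ᵐ x ∂volume.restrict Ω, Tendsto (fun k => z (n k) x) atTop (𝓝 0) := by
  have hp := hpq.lt
  have hp0 : 0 < p := by linarith
  have hconv : ∀ {E : Type} [NormedAddCommGroup E] {w : Euc N → E}, Continuous w →
      HasCompactSupport w → (∫ x, ‖w x‖ ^ p ≤ M) → ∫⁻ x, ‖w x‖ₑ ^ p ≤ ENNReal.ofReal M := by
    intro E _ w hwc hws hle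
    have hi : Integrable fun x => ‖w x‖ ^ p := by
      refine Continuous.integrable_of_hasCompactSupport
        (hwc.norm.rpow_const fun x => Or.inr hp0.le) ?_
      exact hws.norm.comp_left (g := fun t : ℝ => t ^ p) (Real.zero_rpow hp0.ne')
    refine le_trans (le_of_eq ?_) (ENNReal.ofReal_le_ofReal hle)
    rw [ofReal_integral_eq_lintegral_ofReal hi (Eventually.of_forall fun x => by positivity)]
    refine lintegral_congr fun x => ?_
    rw [← ENNReal.ofReal_rpow_of_nonneg (norm_nonneg _) hp0.le, ofReal_norm]
  have hball := fun m : ℕ => tendsto_setLIntegral_ball_rpow (μ := (volume : Measure (Euc N))) hp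
    (fun k => (hz k).1.of_le (by exact_mod_cast le_top)) (fun k => (hz k).2.1)
    (ENNReal.ofReal_ne_top (r := M))
    (fun k => hconv (hz k).continuous (hz k).2.1 (by
      rw [← (hz k).setIntegral_eq]
      · exact hM0 k
      · intro x hx
        simp only [hx, norm_zero, Real.zero_rpow hp0.ne']))
    (fun k => by
      have h1 := hconv (hz k).continuous_gradient (hz k).hasCompactSupport_gradient (by
        rw [← setIntegral_eq_integral_of_forall_compl_eq_zero (s := Ω)]
        · exact hM1 k
        · intro x hx
          have h0 : gradient (z k) x = 0 := by
            rw [gradient_eq_toDual_symm,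
              image_eq_zero_of_notMem_tsupport
                fun h => hx ((hz k).2.2 (tsupport_fderiv_subset ℝ h)), map_zero]
          rw [h0, norm_zero, Real.zero_rpow hp0.ne'])
      refine le_trans (le_of_eq (lintegral_congr fun x => ?_)) h1
      rw [← ofReal_norm, ← ofReal_norm, norm_gradient])
    (fun x δ _ => by
      have hind : MemLp ((Metric.ball x δ).indicator fun _ => (1 : ℝ)) (ENNReal.ofReal q)
          (volume.restrict Ω) :=
        memLp_indicator_const _ measurableSet_ball _ (Or.inr
          ((Measure.restrict_apply_le _ _).trans_lt measure_ball_lt_top).ne)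
      refine (hw _ hind).congr fun k => ?_
      rw [(hz k).setIntegral_eq fun y hy => by simp [hy], ← integral_indicator measurableSet_ball]
      refine integral_congr_ae (Eventually.of_forall fun y => ?_)
      by_cases hy : y ∈ Metric.ball x δ <;> simp [hy]) (m : ℝ)
  obtain ⟨n, hn, hae⟩ := exists_subseq_forall_ae_tendsto_zero (μ := (volume : Measure (Euc N)))
    (g := fun m k => (Metric.ball (0 : Euc N) (m : ℝ)).indicator fun x => ‖z k x‖ₑ ^ p)
    (fun m k => (((hz k).continuous.enorm.measurable.pow_const p).indicator
      measurableSet_ball).aemeasurable)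
    (fun m => by simpa only [lintegral_indicator measurableSet_ball] using hball m)
  refine ⟨n, hn, ae_restrict_of_ae ?_⟩
  filter_upwards [hae] with x hx
  obtain ⟨m, hm⟩ := exists_nat_gt ‖x‖
  have h1 := hx m
  simp only [Set.indicator_of_mem (show x ∈ Metric.ball (0 : Euc N) m by simpa using hm)] at h1
  have h2 := (ENNReal.continuous_rpow_const (y := p⁻¹)).tendsto 0 |>.comp h1
  rw [ENNReal.zero_rpow_of_pos (by positivity)] at h2
  refine tendsto_zero_iff_enorm_tendsto_zero.2 (h2.congr fun k => ?_)
  simp only [Function.comp]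
  rw [← ENNReal.rpow_mul, mul_inv_cancel₀ hp0.ne', ENNReal.rpow_one]

theorem exists_seq_isTestFun_pos (hΩo : IsOpen Ω) (hΩ : Ω.Nonempty) :
    ∃ ψ : ℕ → Euc N → ℝ, (∀ m, IsTestFun Ω (ψ m)) ∧ (∀ m x, 0 ≤ ψ m x) ∧ (∀ m x, ψ m x ≤ 1) ∧
      ∀ x ∈ Ω, ∃ m, 0 < ψ m x := by
  have h : ∀ x : Euc N, ∃ ψ : Euc N → ℝ, IsTestFun Ω ψ ∧ (∀ y, 0 ≤ ψ y) ∧ (∀ y, ψ y ≤ 1) ∧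
      (x ∈ Ω → ψ x = 1) := fun x => by
    by_cases hx : x ∈ Ω
    · obtain ⟨ψ, h1, h2, h3, h4, h5⟩ :=
        exists_contDiff_tsupport_subset (n := ⊤) (hΩo.mem_nhds hx)
      exact ⟨ψ, ⟨h3, h2, h1⟩, fun y => (h4 ⟨y, rfl⟩).1, fun y => (h4 ⟨y, rfl⟩).2, fun _ => h5⟩
    · exact ⟨_, IsTestFun.zero, fun _ => le_rfl, fun _ => zero_le_one, fun h => absurd h hx⟩
  choose ψ h1 h2 h3 h4 using h
  obtain ⟨t, htΩ, htc, hcov⟩ := TopologicalSpace.countable_cover_nhdsWithin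
    (f := fun x => {y | 0 < ψ x y}) (s := Ω) fun x hx => mem_nhdsWithin_of_mem_nhds
      ((isOpen_lt continuous_const (h1 x).continuous).mem_nhds (by simp [h4 x hx]))
  have htne : t.Nonempty := by
    obtain ⟨x, hx⟩ := hΩ
    obtain ⟨y, hy, -⟩ := Set.mem_iUnion₂.1 (hcov hx)
    exact ⟨y, hy⟩
  obtain ⟨e, rfl⟩ := htc.exists_eq_range htne
  refine ⟨fun m => ψ (e m), fun m => h1 _, fun m => h2 _, fun m => h3 _, fun x hx => ?_⟩
  obtain ⟨_, ⟨m, rfl⟩, hy⟩ := Set.mem_iUnion₂.1 (hcov hx)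
  exact ⟨m, hy⟩

theorem exists_le_energy (hpq : p.HolderConjugate q) (hν : IsHardyWeight p Ω ν)
    (hg : MemLp g (ENNReal.ofReal q) (volume.restrict Ω))
    (hG : MemLp G (ENNReal.ofReal q) (volume.restrict Ω)) (hε0 : 0 < ε) (hε1 : ε < 1) :
    ∃ K, ∀ ζ, IsTestFun Ω ζ → ε / (2 * p) * ((∫ x in Ω, ‖gradient ζ x‖ ^ p) +
      ∫ x in Ω, ‖ζ x‖ ^ p) - K ≤ energy p ε Ω ν g G ζ (gradient ζ) := by
  have hp := hpq.lt
  have hp0 : 0 < p := by linarith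
  obtain ⟨K1, hK1⟩ := exists_mul_le_rpow_add hp
    (A := (∫ x in Ω, ‖g x‖ ^ q) ^ (1 / q))
    (Real.rpow_nonneg (integral_nonneg fun x => by positivity) _)
    (show 0 < ε / (2 * p) by positivity)
  obtain ⟨K2, hK2⟩ := exists_mul_le_rpow_add hp
    (A := (∫ x in Ω, ‖G x‖ ^ q) ^ (1 / q))
    (Real.rpow_nonneg (integral_nonneg fun x => by positivity) _)
    (show 0 < ε / (2 * p) by positivity)
  refine ⟨K1 + K2, fun ζ hζ => ?_⟩
  have hA : 0 ≤ ∫ x in Ω, ‖gradient ζ x‖ ^ p := integral_nonneg fun x => by positivity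
  have hL : 0 ≤ ∫ x in Ω, ‖ζ x‖ ^ p := integral_nonneg fun x => by positivity
  have h1 := (le_abs_self _).trans ((abs_integral_inner_le hpq hg (hζ.memLp _)).trans
    (hK1 _ (Real.rpow_nonneg hL _)))
  have h2 := (le_abs_self _).trans ((abs_integral_inner_le hpq hG (hζ.memLp_gradient _)).trans
    (hK2 _ (Real.rpow_nonneg hA _)))
  rw [← Real.rpow_mul hL, one_div_mul_cancel hp0.ne', Real.rpow_one] at h1
  rw [← Real.rpow_mul hA, one_div_mul_cancel hp0.ne', Real.rpow_one] at h2
  have h3 := mul_le_mul_of_nonneg_left (hν.le _ hζ)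
    (div_nonneg (sub_nonneg.2 hε1.le) hp0.le : 0 ≤ (1 - ε) / p)
  simp only [energy]
  have e1 : (1 - ε) / p = 1 / p - 2 * (ε / (2 * p)) := by field_simp
  have e2 : ε / p = 2 * (ε / (2 * p)) := by field_simp
  rw [e2]
  rw [e1] at h3 ⊢
  linarith

end Minimizers

section Existence

variable {N : ℕ} {Ω : Set (Euc N)} {p q ε : ℝ} {ν : Measure (Euc N)} {g : Euc N → ℝ}
  {G : Euc N → Euc N}

/-- Lower semicontinuity of the energy along almost everywhere convergent sequences. -/
theorem energy_le_of_ae_tendsto (hpq : p.HolderConjugate q) (hν : IsHardyWeight p Ω ν)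
    (hε0 : 0 < ε) (hε1 : ε < 1) {u : ℕ → Euc N → ℝ} (hu : ∀ k, IsTestFun Ω (u k))
    {u0 : Euc N → ℝ} {v0 : Euc N → Euc N} (hW : IsSobolevZero p Ω u0 v0)
    {M : ℝ} (hM0 : ∀ k, ∫ x in Ω, ‖u k x‖ ^ p ≤ M)
    (hM1 : ∀ k, ∫ x in Ω, ‖gradient (u k) x‖ ^ p ≤ M)
    (hwg : Tendsto (fun k => ∫ x in Ω, ⟪g x, u k x⟫) atTop (𝓝 (∫ x in Ω, ⟪g x, u0 x⟫)))
    (hwG : Tendsto (fun k => ∫ x in Ω, ⟪G x, gradient (u k) x⟫) atTop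
      (𝓝 (∫ x in Ω, ⟪G x, v0 x⟫)))
    (hae : ∀ᵐ x ∂volume.restrict Ω, Tendsto (fun k => u k x) atTop (𝓝 (u0 x)))
    (haeG : ∀ᵐ x ∂volume.restrict Ω, Tendsto (fun k => gradient (u k) x) atTop (𝓝 (v0 x)))
    {c : ℝ} (hlim : Tendsto (fun k => energy p ε Ω ν g G (u k) (gradient (u k))) atTop (𝓝 c)) :
    energy p ε Ω ν g G u0 v0 ≤ c := by
  have hp := hpq.lt
  have hp0 : 0 < p := by linarith
  have hA := tendsto_integral_norm_rpow_sub_of_ae hp (fun k => (hu k).memLp_gradient _) hW.2.1 hM1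
    haeG
  have hL := tendsto_integral_norm_rpow_sub_of_ae hp (fun k => (hu k).memLp _) hW.1 hM0 hae
  have hB := tendsto_integral_norm_rpow_sub_of_ae hp (fun k => hν.memLp _ (hu k))
    (hν.memLp_and_le hp hW).1 (fun k => (hν.le _ (hu k)).trans (hM1 k)) (hν.ac.ae_le hae)
  refine le_of_tendsto_of_tendsto' ((((hA.const_mul (1 / p)).sub
    (hB.const_mul ((1 - ε) / p))).add (hL.const_mul (ε / p))).sub (hwg.add hwG)) hlim fun k => ?_
  have h1 := (hν.memLp_and_le hp ((IsSobolevZero.of_isTestFun hp (hu k)).sub hp hW)).2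
  have h2 : 0 ≤ ∫ x in Ω, ‖gradient (u k) x - v0 x‖ ^ p :=
    integral_nonneg fun x => by positivity
  have h3 : 0 ≤ ε / p * ∫ x in Ω, ‖u k x - u0 x‖ ^ p :=
    mul_nonneg (by positivity) (integral_nonneg fun x => by positivity)
  have h4 := mul_le_mul_of_nonneg_left h1
    (div_nonneg (sub_nonneg.2 hε1.le) hp0.le : 0 ≤ (1 - ε) / p)
  have h5 : (1 - ε) / p * ∫ x in Ω, ‖gradient (u k) x - v0 x‖ ^ p ≤
      1 / p * ∫ x in Ω, ‖gradient (u k) x - v0 x‖ ^ p := by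
    refine mul_le_mul_of_nonneg_right ?_ h2
    gcongr
    linarith
  simp only [energy]
  linarith

theorem ae_tendsto_gradient_of_localized (hp : 1 < p) (hΩo : IsOpen Ω) (hΩ : Ω.Nonempty)
    {u z : ℕ → Euc N → ℝ} (hu : ∀ k, IsTestFun Ω (u k)) (hz : ∀ k, IsTestFun Ω (z k))
    {v : Euc N → Euc N} (hv : MemLp v (ENNReal.ofReal p) (volume.restrict Ω))
    (hz0 : ∀ᵐ x ∂volume.restrict Ω, Tendsto (fun k => z k x) atTop (𝓝 0))
    (hloc : ∀ ψ, IsTestFun Ω ψ → (∀ x, 0 ≤ ψ x) → (∀ x, ψ x ≤ 1) →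
      Tendsto (fun k => ∫ x in Ω, ψ x / (1 + z k x ^ 2) * ‖gradient (u k) x - v x‖ ^ p) atTop
        (𝓝 0)) :
    ∃ n : ℕ → ℕ, StrictMono n ∧
      ∀ᵐ x ∂volume.restrict Ω, Tendsto (fun k => gradient (u (n k)) x) atTop (𝓝 (v x)) := by
  obtain ⟨ψ, hψ, hψ0, hψ1, hpos⟩ := exists_seq_isTestFun_pos hΩo hΩ
  have hθ0 : ∀ m k x, 0 ≤ ψ m x / (1 + z k x ^ 2) := fun m k x =>
    div_nonneg (hψ0 m x) (by positivity)
  obtain ⟨n, hn, hae⟩ := exists_subseq_forall_ae_tendsto_zero_real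
    (g := fun m k x => ψ m x / (1 + z k x ^ 2) * ‖gradient (u k) x - v x‖ ^ p)
    (μ := volume.restrict Ω)
    (fun m k => ((((hu k).memLp_gradient _).sub hv).integrable_rpow hp).bdd_mul (c := 1)
      ((hψ m).continuous.div (by have := (hz k).continuous; fun_prop)
        fun x => by positivity).aestronglyMeasurable
      (Eventually.of_forall fun x => by
        rw [Real.norm_of_nonneg (hθ0 m k x), div_le_one (by positivity)]
        nlinarith [hψ1 m x, sq_nonneg (z k x)]))
    (fun m k x => mul_nonneg (hθ0 m k x) (by positivity))
    (fun m => hloc _ (hψ m) (hψ0 m) (hψ1 m))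
  refine ⟨n, hn, ?_⟩
  have hmem : ∀ᵐ x ∂volume.restrict Ω, x ∈ Ω := ae_restrict_mem hΩo.measurableSet
  filter_upwards [hae, hz0, hmem] with x hx hzx hxΩ
  obtain ⟨m, hm⟩ := hpos x hxΩ
  refine tendsto_of_norm_sub_rpow hp ?_
  have h1 : Tendsto (fun k => (1 + z (n k) x ^ 2) / ψ m x) atTop (𝓝 ((1 + 0 ^ 2) / ψ m x)) :=
    (((hzx.comp hn.tendsto_atTop).pow 2).const_add 1).div_const _
  have h2 := h1.mul (hx m)
  rw [mul_zero] at h2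
  refine h2.congr fun k => ?_
  have h3 : 1 + z (n k) x ^ 2 ≠ 0 := by positivity
  field_simp

theorem exists_minimizer (hpq : p.HolderConjugate q) (hΩo : IsOpen Ω) (hΩ : Ω.Nonempty)
    (hν : IsHardyWeight p Ω ν) (hg : MemLp g (ENNReal.ofReal q) (volume.restrict Ω))
    (hG : MemLp G (ENNReal.ofReal q) (volume.restrict Ω)) (hε0 : 0 < ε) (hε1 : ε < 1) :
    ∃ u v, IsSobolevZero p Ω u v ∧
      ∀ ζ, IsTestFun Ω ζ → energy p ε Ω ν g G u v ≤ energy p ε Ω ν g G ζ (gradient ζ) := by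
  have hp := hpq.lt
  have hp0 : 0 < p := by linarith
  obtain ⟨K, hK⟩ := exists_le_energy hpq hν hg hG hε0 hε1
  set S : Set ℝ := {e | ∃ ζ, IsTestFun Ω ζ ∧ energy p ε Ω ν g G ζ (gradient ζ) = e} with hS
  have hnn : ∀ ζ : Euc N → ℝ, 0 ≤ ∫ x in Ω, ‖ζ x‖ ^ p := fun ζ =>
    integral_nonneg fun x => by positivity
  have hnnG : ∀ ζ : Euc N → ℝ, 0 ≤ ∫ x in Ω, ‖gradient ζ x‖ ^ p := fun ζ =>
    integral_nonneg fun x => by positivity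
  have hSb : BddBelow S := by
    refine ⟨-K, ?_⟩
    rintro _ ⟨ζ, hζ, rfl⟩
    have h1 : 0 ≤ ε / (2 * p) * ((∫ x in Ω, ‖gradient ζ x‖ ^ p) + ∫ x in Ω, ‖ζ x‖ ^ p) :=
      mul_nonneg (by positivity) (add_nonneg (hnnG ζ) (hnn ζ))
    linarith [hK ζ hζ]
  obtain ⟨e, -, he, hmem⟩ := exists_seq_tendsto_sInf (S := S) ⟨_, _, IsTestFun.zero, rfl⟩ hSb
  choose w hw hwe using hmem
  have hc : ∀ ζ, IsTestFun Ω ζ → sInf S ≤ energy p ε Ω ν g G ζ (gradient ζ) := fun ζ hζ =>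
    csInf_le hSb ⟨ζ, hζ, rfl⟩
  obtain ⟨B, hB⟩ := he.bddAbove_range
  have hbd : ∀ k, (∫ x in Ω, ‖gradient (w k) x‖ ^ p) + ∫ x in Ω, ‖w k x‖ ^ p ≤
      (B + K) / (ε / (2 * p)) := fun k => by
    rw [le_div_iff₀ (by positivity)]
    linarith [hK _ (hw k), hwe k, hB (Set.mem_range_self k)]
  set M := (B + K) / (ε / (2 * p))
  obtain ⟨n, hn, u0, v0, hW, hwu, hwG⟩ := exists_subseq_weak_limit hpq hw (M := M)
    (fun k => by linarith [hbd k, hnnG (w k)]) (fun k => by linarith [hbd k, hnn (w k)])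
  obtain ⟨φ, hφ, hφu, hφv⟩ := hW.2.2
  obtain ⟨M0, hM0⟩ := exists_forall_integral_norm_rpow_le hp (fun k => (hφ k).memLp _) hW.1 hφu
  obtain ⟨M1, hM1⟩ := exists_forall_integral_norm_rpow_le hp (fun k => (hφ k).memLp_gradient _)
    hW.2.1 hφv
  obtain ⟨n', hn', hz⟩ := IsTestFun.exists_subseq_ae_tendsto_zero hpq
    (fun k => (hw (n k)).sub (hφ k)) (M := 2 ^ p * (M + (M0 ⊔ M1)))
    (fun k => by
      refine (integral_norm_sub_rpow_le hp ((hw (n k)).memLp _) ((hφ k).memLp _)).trans ?_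
      refine mul_le_mul_of_nonneg_left (add_le_add ?_ ((hM0 k).trans le_sup_left)) (by positivity)
      linarith [hbd (n k), hnnG (w (n k))])
    (fun k => by
      simp only [(hw (n k)).gradient_sub (hφ k)]
      refine (integral_norm_sub_rpow_le hp ((hw (n k)).memLp_gradient _)
        ((hφ k).memLp_gradient _)).trans ?_
      refine mul_le_mul_of_nonneg_left (add_le_add ?_ ((hM1 k).trans le_sup_right))
        (by positivity)
      linarith [hbd (n k), hnn (w (n k))])
    (fun h hh => by
      have h1 := (hwu h hh).sub
        (tendsto_integral_inner_of_sub hpq hh (fun k => (hφ k).memLp _) hW.1 hφu)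
      rw [sub_self] at h1
      refine h1.congr fun k => ?_
      simp_rw [inner_sub_right]
      exact (integral_sub (integrable_inner_of_memLp hpq hh ((hw (n k)).memLp _))
        (integrable_inner_of_memLp hpq hh ((hφ k).memLp _))).symm)
  have hn't := hn'.tendsto_atTop
  obtain ⟨m, hm, hφae⟩ := exists_subseq_ae_tendsto hp (fun k => (hφ (n' k)).memLp _) hW.1
    (hφu.comp hn't)
  have hmt := hm.tendsto_atTop
  have hst : Tendsto (fun k => n' (m k)) atTop atTop := hn't.comp hmt
  have hlim : Tendsto (fun k => energy p ε Ω ν g G (w (n k)) (gradient (w (n k)))) atTop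
      (𝓝 (sInf S)) := by
    simp only [hwe]
    exact he.comp hn.tendsto_atTop
  have hz' : ∀ᵐ x ∂volume.restrict Ω,
      Tendsto (fun k => w (n (n' (m k))) x - φ (n' (m k)) x) atTop (𝓝 0) := by
    filter_upwards [hz] with x hx
    exact hx.comp hmt
  obtain ⟨l, hl, hgrad⟩ := ae_tendsto_gradient_of_localized hp hΩo hΩ
    (fun k => hw (n (n' (m k)))) (fun k => (hw (n (n' (m k)))).sub (hφ (n' (m k)))) hW.2.1 hz'
    (fun ψ hψ hψ0 hψ1 => tendsto_localized_gradient hpq hν hg hG (fun k => hw (n (n' (m k))))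
      (fun k => hφ (n' (m k))) hW.2.1 (M := M)
      (fun k => by linarith [hbd (n (n' (m k))), hnnG (w (n (n' (m k))))])
      (fun k => by linarith [hbd (n (n' (m k))), hnn (w (n (n' (m k))))])
      (hφv.comp hst) (fun H hH => (hwG H hH).comp hst) hz' hc (hlim.comp hst) hψ hψ0 hψ1)
  have hlt := hl.tendsto_atTop
  have hae : ∀ᵐ x ∂volume.restrict Ω,
      Tendsto (fun k => w (n (n' (m (l k)))) x) atTop (𝓝 (u0 x)) := by
    filter_upwards [hz', hφae] with x hx hx'
    have h1 := (hx.add hx').comp hlt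
    rw [zero_add] at h1
    exact h1.congr fun k => by simp
  refine ⟨u0, v0, hW, fun ζ hζ => le_trans ?_ (hc ζ hζ)⟩
  exact energy_le_of_ae_tendsto hpq hν hε0 hε1 (fun k => hw (n (n' (m (l k))))) hW (M := M)
    (fun k => by linarith [hbd (n (n' (m (l k)))), hnnG (w (n (n' (m (l k)))))])
    (fun k => by linarith [hbd (n (n' (m (l k)))), hnn (w (n (n' (m (l k)))))])
    ((hwu g hg).comp (hst.comp hlt)) ((hwG G hG).comp (hst.comp hlt)) hae hgrad
    (hlim.comp (hst.comp hlt))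

end Existence

section Weight

variable {N : ℕ} {Ω : Set (Euc N)} {p : ℝ} {V : Euc N → ℝ}

/-- The measure with density `V` on `Ω`. -/
def weightMeasure (Ω : Set (Euc N)) (V : Euc N → ℝ) : Measure (Euc N) :=
  (volume.restrict Ω).withDensity fun x => ENNReal.ofReal (V x)

theorem integral_weightMeasure (hΩo : IsOpen Ω) (hV0 : ∀ x ∈ Ω, 0 ≤ V x)
    (hVloc : LocallyIntegrableOn V Ω) (h : Euc N → ℝ) :
    ∫ x, h x ∂weightMeasure Ω V = ∫ x in Ω, V x * h x := by
  rw [weightMeasure, integral_withDensity_eq_integral_toReal_smul₀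
    hVloc.aestronglyMeasurable.aemeasurable.ennreal_ofReal
    (Eventually.of_forall fun x => ENNReal.ofReal_lt_top)]
  refine setIntegral_congr_fun hΩo.measurableSet fun x hx => ?_
  simp only [ENNReal.toReal_ofReal (hV0 x hx), smul_eq_mul]

theorem integrable_weightMeasure_iff (hΩo : IsOpen Ω) (hV0 : ∀ x ∈ Ω, 0 ≤ V x)
    (hVloc : LocallyIntegrableOn V Ω) (h : Euc N → ℝ) :
    Integrable h (weightMeasure Ω V) ↔ IntegrableOn (fun x => V x * h x) Ω := by
  rw [weightMeasure, integrable_withDensity_iff_integrable_smul₀'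
    hVloc.aestronglyMeasurable.aemeasurable.ennreal_ofReal
    (Eventually.of_forall fun x => ENNReal.ofReal_lt_top)]
  refine integrableOn_congr_fun (fun x hx => ?_) hΩo.measurableSet
  simp only [ENNReal.toReal_ofReal (hV0 x hx), smul_eq_mul]

theorem isHardyWeight_weightMeasure (hp : 1 < p) (hΩo : IsOpen Ω) (hV0 : ∀ x ∈ Ω, 0 ≤ V x)
    (hVloc : LocallyIntegrableOn V Ω)
    (hQpos : ∀ w : Euc N → ℝ, IsTestFun Ω w → w ≠ 0 → 0 < QV p Ω V w) :
    IsHardyWeight p Ω (weightMeasure Ω V) where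
  ac := withDensity_absolutelyContinuous _ _
  memLp ζ hζ := by
    have hp0 : 0 < p := by linarith
    refine memLp_of_integrable_rpow hp hζ.continuous.aestronglyMeasurable ?_
    rw [integrable_weightMeasure_iff hΩo hV0 hVloc]
    have hc : Continuous fun x => ‖ζ x‖ ^ p :=
      hζ.continuous.norm.rpow_const fun x => Or.inr hp0.le
    have hi := (hVloc.integrableOn_compact_subset hζ.2.2 hζ.2.1).mul_continuousOn
      hc.continuousOn hζ.2.1
    refine (integrableOn_iff_integrable_of_support_subset (s := tsupport ζ) ?_).1 hi |>.integrableOn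
    intro x hx
    refine subset_tsupport ζ fun h0 => hx ?_
    simp [h0, Real.zero_rpow hp0.ne']
  le ζ hζ := by
    rw [integral_weightMeasure hΩo hV0 hVloc]
    by_cases h0 : ζ = 0
    · have hp0 : p ≠ 0 := by linarith
      simp only [h0, Pi.zero_apply, norm_zero, Real.zero_rpow hp0, mul_zero, integral_zero]
      exact integral_nonneg fun x => by positivity
    · have h1 := hQpos ζ hζ h0
      simp only [QV, sub_pos] at h1
      exact h1.le

end Weight

/-- solvability of the approximate problem: the perturbed functional `φ`
attains its minimum at some `u ∈ W^{1,p}_0(Ω)` which solves the perturbed equation. -/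
theorem stmt4 (N : ℕ) (p : ℝ) (hp : 1 < p) (ε : ℝ) (hε0 : 0 < ε) (hε1 : ε < 1)
    (Ω : Set (Euc N)) (hΩo : IsOpen Ω) (hΩc : IsConnected Ω)
    (V : Euc N → ℝ) (hV0 : ∀ x ∈ Ω, 0 ≤ V x) (hVloc : LocallyIntegrableOn V Ω)
    (hQpos : ∀ w : Euc N → ℝ, IsTestFun Ω w → w ≠ 0 → 0 < QV p Ω V w)
    (f : (Euc N → ℝ) → ℝ)
    (hflin : ∀ (a b : ℝ) (ζ η : Euc N → ℝ), IsTestFun Ω ζ → IsTestFun Ω η →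
      f (fun x => a * ζ x + b * η x) = a * f ζ + b * f η)
    (C : ℝ) (hC : 0 ≤ C)
    (hfbound : ∀ ζ : Euc N → ℝ, IsTestFun Ω ζ →
      |f ζ| ≤ C * (∫ x in Ω, (|ζ x| ^ p + ‖gradient ζ x‖ ^ p)) ^ (1 / p)) :
    ∃ (u : Euc N → ℝ) (v : Euc N → Euc N),
      IntegrableOn (fun x => |u x| ^ p) Ω ∧
      IntegrableOn (fun x => ‖v x‖ ^ p) Ω ∧
      HasWeakGradOn Ω u v ∧
      (∃ φ : ℕ → Euc N → ℝ, (∀ j, IsTestFun Ω (φ j)) ∧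
        Tendsto (fun j => ∫ x in Ω,
            (|u x - φ j x| ^ p + ‖v x - gradient (φ j) x‖ ^ p)) atTop (𝓝 0)) ∧
      IntegrableOn (fun x => V x * |u x| ^ p) Ω ∧
      (∀ ζ : Euc N → ℝ, IsTestFun Ω ζ →
        (∫ x in Ω, ⟪pvec p (v x), gradient ζ x⟫)
          - (1 - ε) * (∫ x in Ω, V x * psc p (u x) * ζ x)
          + ε * (∫ x in Ω, psc p (u x) * ζ x) = f ζ) ∧
      (∀ ζ : Euc N → ℝ, IsTestFun Ω ζ →
        (1 / p - 1) * ((∫ x in Ω, ‖v x‖ ^ p)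
            - (1 - ε) * (∫ x in Ω, V x * |u x| ^ p) + ε * (∫ x in Ω, |u x| ^ p))
          ≤ (1 / p) * (∫ x in Ω, ‖gradient ζ x‖ ^ p)
            - ((1 - ε) / p) * (∫ x in Ω, V x * |ζ x| ^ p)
            + (ε / p) * (∫ x in Ω, |ζ x| ^ p) - f ζ) := by
  have hp0 : 0 < p := by linarith
  have hpq := Real.HolderConjugate.conjExponent hp
  have hν := isHardyWeight_weightMeasure hp hΩo hV0 hVloc hQpos
  obtain ⟨g, G, hg, hG, hf⟩ := exists_representation hpq hflin hC hfbound
  obtain ⟨u, v, hW, hmin⟩ := exists_minimizer hpq hΩo hΩc.nonempty hν hg hG hε0 hε1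
  have hEL := fun h k => euler_lagrange hpq hν hg hG hW hmin (h := h) (k := k)
  obtain ⟨φ, hφ, hφu, hφv⟩ := hW.2.2
  refine ⟨u, v, hW.1.integrable_rpow hp, hW.2.1.integrable_rpow hp, hW.hasWeakGradOn hpq,
    ⟨φ, hφ, ?_⟩, ?_, fun ζ hζ => ?_, fun ζ hζ => ?_⟩
  · have h1 := hφu.add hφv
    rw [add_zero] at h1
    refine h1.congr fun j => ?_
    refine (integral_add ((((hφ j).memLp _).sub hW.1).integrable_rpow hp)
      ((((hφ j).memLp_gradient _).sub hW.2.1).integrable_rpow hp)).symm.trans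
      (integral_congr_ae (Eventually.of_forall fun x => ?_))
    simp only [Pi.sub_apply, Real.norm_eq_abs]
    rw [abs_sub_comm, norm_sub_rev]
  · exact (integrable_weightMeasure_iff hΩo hV0 hVloc _).1
      ((hν.memLp_and_le hp hW).1.integrable_rpow hp)
  · rw [hf ζ hζ, ← hEL _ _ (IsSobolevZero.of_isTestFun hp hζ),
      integral_weightMeasure hΩo hV0 hVloc]
    simp only [pvec, psc, RCLike.inner_apply, conj_trivial, smul_eq_mul, Real.norm_eq_abs,
      mul_comm (ζ _), mul_assoc]
  · have h1 := hmin ζ hζ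
    have h2 := hEL _ _ hW
    have hpow : ∀ {E : Type} [NormedAddCommGroup E] [InnerProductSpace ℝ E] (s : E),
        ⟪‖s‖ ^ (p - 2) • s, s⟫ = ‖s‖ ^ p := by
      intro E _ _ s
      rw [real_inner_smul_left, real_inner_self_eq_norm_sq, ← Real.rpow_natCast,
        ← Real.rpow_add' (norm_nonneg _) (by push_cast; linarith)]
      congr 1
      push_cast
      ring
    simp only [hpow] at h2
    simp only [energy, ← h2, integral_weightMeasure hΩo hV0 hVloc, ← hf ζ hζ,
      Real.norm_eq_abs] at h1
    refine le_trans (le_of_eq ?_) h1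
    field_simp
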